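/- arXiv:1608.06969 — 3 statements merged into one kernel-verified Lean document; each statement's English description precedes it below -/
import Mathlib

section
/- If C and D are permutation classes each possessing a finite proper growth rate (gr(C) = lim_{n→∞} |C_n|^{1/n} and gr(D) = lim_{n→∞} |D_n|^{1/n} exist and are finite), then the lower growth rate of any infinite (C,D) staircase S satisfies liminf_{n→∞} |S_n|^{1/n} ≥ (√gr(C) + √gr(D))². -/
open Filter Topology ENNReal

/-- A permutation of length `n`, in one-line notation `π 0, π 1, …, π (n-1)`. -/
abbrev Perm (n : ℕ) := Equiv.Perm (Fin n)

/-- `Pattern σ π` : the permutation `σ` is contained in `π`, i.e. some subsequence of `π`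
is order isomorphic to `σ`. -/
def Pattern {k n : ℕ} (σ : Perm k) (π : Perm n) : Prop :=
  ∃ f : Fin k ↪o Fin n, ∀ i j : Fin k, σ i < σ j ↔ π (f i) < π (f j)

/-- A permutation class: a set of permutations closed downwards under containment. -/
structure PermClass where
  mem : ∀ n, Set (Perm n)
  closed : ∀ {k n : ℕ} (σ : Perm k) (π : Perm n), π ∈ mem n → Pattern σ π → σ ∈ mem k

/-- The entries of `π` at the positions in `A` form a sequence order isomorphic
to a member of the family `F`. -/
def SubpermIn {n : ℕ} (π : Perm n) (A : Set (Fin n)) (F : ∀ m, Set (Perm m)) : Prop :=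
  ∃ (m : ℕ) (σ : Perm m) (f : Fin m ↪o Fin n),
    Set.range ⇑f = A ∧ (∀ i j : Fin m, σ i < σ j ↔ π (f i) < π (f j)) ∧ σ ∈ F m

/-- The merge `C ⊙ D`: permutations whose entries can be partitioned into a subsequence
order isomorphic to a member of `C` and one order isomorphic to a member of `D`. -/
def mergeSet (C D : ∀ m, Set (Perm m)) (n : ℕ) : Set (Perm n) :=
  {π | ∃ A : Set (Fin n), SubpermIn π A C ∧ SubpermIn π Aᶜ D}

/-- `|F_n| ^ (1/n)` as a real number. -/
noncomputable def growthSeq (F : ∀ m, Set (Perm m)) (n : ℕ) : ℝ :=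
  ((F n).ncard : ℝ) ^ ((n : ℝ)⁻¹)

/-- The family `F` has (finite) proper growth rate `g`. -/
def HasGrowth (F : ∀ m, Set (Perm m)) (g : ℝ) : Prop :=
  Tendsto (growthSeq F) atTop (𝓝 g)

/-- `|F_n| ^ (1/n)` in the extended nonnegative reals. -/
noncomputable def eGrowthSeq (F : ∀ m, Set (Perm m)) (n : ℕ) : ℝ≥0∞ :=
  ((F n).ncard : ℝ≥0∞) ^ ((n : ℝ)⁻¹)

/-- The upper growth rate `limsup |F_n|^(1/n)`. -/
noncomputable def ugr (F : ∀ m, Set (Perm m)) : ℝ≥0∞ := limsup (eGrowthSeq F) atTop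

/-- The lower growth rate `liminf |F_n|^(1/n)`. -/
noncomputable def lgr (F : ∀ m, Set (Perm m)) : ℝ≥0∞ := liminf (eGrowthSeq F) atTop

/-- The direct sum `π ⊕ σ` of two permutations. -/
def dsum {m n : ℕ} (π : Perm m) (σ : Perm n) : Perm (m + n) :=
  finSumFinEquiv.symm.trans ((Equiv.sumCongr π σ).trans finSumFinEquiv)

/-- The skew sum `π ⊖ σ` of two permutations. -/
def skewSum {m n : ℕ} (π : Perm m) (σ : Perm n) : Perm (m + n) :=
  finSumFinEquiv.symm.trans ((Equiv.sumCongr π σ).trans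
    (((Equiv.sumComm (Fin m) (Fin n)).trans finSumFinEquiv).trans (finCongr (Nat.add_comm n m))))

/-- A family of permutations is sum closed if it is closed under `⊕`. -/
def SumClosed (F : ∀ m, Set (Perm m)) : Prop :=
  ∀ {m n : ℕ} (π : Perm m) (σ : Perm n), π ∈ F m → σ ∈ F n → dsum π σ ∈ F (m + n)

/-- A family of permutations is skew closed if it is closed under `⊖`. -/
def SkewClosed (F : ∀ m, Set (Perm m)) : Prop :=
  ∀ {m n : ℕ} (π : Perm m) (σ : Perm n), π ∈ F m → σ ∈ F n → skewSum π σ ∈ F (m + n)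

/-- The class of an empty (blocked) grid cell: only the empty permutation. -/
def emptyCell : ∀ m, Set (Perm m) := fun m => {_π | m = 0}

/-- The set of positions of `π` lying in column `k` and row `ℓ` of the gridding
determined by the column divisions `c` and row divisions `r`. -/
def cellSet {n : ℕ} (π : Perm n) (c r : ℕ → ℕ) (k ℓ : ℕ) : Set (Fin n) :=
  {i | c k ≤ (i : ℕ) ∧ (i : ℕ) < c (k + 1) ∧ r ℓ ≤ (π i : ℕ) ∧ (π i : ℕ) < r (ℓ + 1)}

/-- The grid class of an (infinite) matrix `M` of families of permutations, where
`M k ℓ` is the cell in column `k`, row `ℓ` (Cartesian coordinates, indexed from 0). -/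
def gridSet (M : ℕ → ℕ → ∀ m, Set (Perm m)) (n : ℕ) : Set (Perm n) :=
  {π | ∃ c r : ℕ → ℕ, Monotone c ∧ Monotone r ∧ c 0 = 0 ∧ r 0 = 0 ∧
    (∀ k, c k ≤ n) ∧ (∀ ℓ, r ℓ ≤ n) ∧ (∃ k, c k = n) ∧ (∃ ℓ, r ℓ = n) ∧
    ∀ k ℓ, cellSet π c r k ℓ = ∅ ∨ SubpermIn π (cellSet π c r k ℓ) (M k ℓ)}

/-- The matrix of the infinite increasing `(C, D)` staircase: cell in column `i`, row `i`
is `C`, cell in column `i+1`, row `i` is `D`, all other cells empty. -/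
def incStairM (C D : ∀ m, Set (Perm m)) : ℕ → ℕ → ∀ m, Set (Perm m) :=
  fun k ℓ => if k = ℓ then C else if k = ℓ + 1 then D else emptyCell

/-- The decreasing permutation `k (k-1) ⋯ 2 1` of length `k`. -/
def delta (k : ℕ) : Perm k := ⟨Fin.rev, Fin.rev, Fin.rev_rev, Fin.rev_rev⟩

/-- The class of permutations avoiding the pattern `τ`. -/
def avSet {k : ℕ} (τ : Perm k) : ∀ n, Set (Perm n) := fun n => {π | ¬ Pattern τ π}

/-- The shape of an infinite `(C,D)` staircase: `pos j` is the (column, row) position of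
the `(j+1)`-st cell; odd-indexed steps share a row with their predecessor, even-indexed
steps share a column with their predecessor, and no other sharing of rows or columns occurs. -/
structure StaircaseData where
  pos : ℕ → ℕ × ℕ
  inj : Function.Injective pos
  rowEq : ∀ i, (pos (2 * i + 1)).2 = (pos (2 * i)).2
  colEq : ∀ i, (pos (2 * i + 2)).1 = (pos (2 * i + 1)).1
  rowOnly : ∀ j j', (pos j).2 = (pos j').2 → j / 2 = j' / 2
  colOnly : ∀ j j', (pos j).1 = (pos j').1 → (j + 1) / 2 = (j' + 1) / 2

open Classical in
/-- The matrix of the infinite `(C,D)` staircase with shape `S`: the odd-numbered cells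
(cells `1, 3, 5, …`, i.e. `pos 0, pos 2, …`) are `C`, the even-numbered cells are `D`. -/
noncomputable def StaircaseData.M (S : StaircaseData) (C D : ∀ m, Set (Perm m)) :
    ℕ → ℕ → ∀ m, Set (Perm m) :=
  fun k ℓ => if ∃ i, S.pos (2 * i) = (k, ℓ) then C
    else if ∃ i, S.pos (2 * i + 1) = (k, ℓ) then D else emptyCell

open Classical in
/-- The matrix of the `t`-step restriction of the staircase: only the first `2t` cells. -/
noncomputable def StaircaseData.Mstep (S : StaircaseData) (C D : ∀ m, Set (Perm m)) (t : ℕ) :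
    ℕ → ℕ → ∀ m, Set (Perm m) :=
  fun k ℓ => if ∃ i < t, S.pos (2 * i) = (k, ℓ) then C
    else if ∃ i < t, S.pos (2 * i + 1) = (k, ℓ) then D else emptyCell

/-- The shuffles of a chain of length `a` with a chain of length `b`. -/
def Shuffle (a b : ℕ) : Type :=
  {e : Fin a ⊕ Fin b ≃ Fin (a + b) //
    StrictMono (fun x => e (Sum.inl x)) ∧ StrictMono (fun y => e (Sum.inr y))}

instance (a b : ℕ) : Finite (Shuffle a b) := Subtype.finite

instance (a b : ℕ) : Inhabited (Shuffle a b) :=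
  ⟨⟨finSumFinEquiv, Fin.strictMono_castAdd b, Fin.strictMono_natAdd a⟩⟩

theorem choose_le_card_shuffle (a b : ℕ) : (a + b).choose a ≤ Nat.card (Shuffle a b) := by
  have hcard (A : Set.powersetCard (Fin (a + b)) a) : (A : Finset (Fin (a + b)))ᶜ.card = b := by
    rw [Finset.card_compl, A.2]; simp
  let f : Set.powersetCard (Fin (a + b)) a → Shuffle a b := fun A =>
    ⟨finSumEquivOfFinset A.2 (hcard A), (Finset.orderEmbOfFin _ A.2).strictMono,
      (Finset.orderEmbOfFin _ (hcard A)).strictMono⟩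
  have hf : Function.Injective f := fun A B h => by
    have hset (A : Set.powersetCard (Fin (a + b)) a) :
        Set.range (fun x => (f A).1 (Sum.inl x)) = (A : Finset (Fin (a + b))) := by
      simp only [f]
      exact Finset.range_orderEmbOfFin _ A.2
    apply Subtype.ext
    rw [← Finset.coe_inj, ← hset A, ← hset B, h]
  have := Nat.card_le_card_of_injective f hf
  rwa [Set.powersetCard.card, Nat.card_eq_fintype_card, Fintype.card_fin] at this

theorem equiv_fin_eq_of_lt_iff_lt {α : Type*} {n : ℕ} {e e' : α ≃ Fin n}
    (h : ∀ x y, e x < e y ↔ e' x < e' y) : e = e' := by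
  let o : Fin n ≃o Fin n :=
    { e.symm.trans e' with
      map_rel_iff' := fun {x y} => by
        rw [← not_lt, ← not_lt]
        simpa using (h (e.symm y) (e.symm x)).symm.not }
  have ho : o = OrderIso.refl _ := Subsingleton.elim _ _
  ext x
  have : o (e x) = e x := by rw [ho]; rfl
  simpa [o] using congrArg Fin.val this.symm

theorem exists_equiv_fin_lt_iff {α K : Type*} [Fintype α] [LinearOrder K] {n : ℕ}
    (hn : Fintype.card α = n) {q : α → K} (hq : Function.Injective q) :
    ∃ e : α ≃ Fin n, ∀ x y, e x < e y ↔ q x < q y := by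
  let _ : LinearOrder α := LinearOrder.lift' q hq
  exact ⟨(Fintype.orderIsoFinOfCardEq α hn).symm.toEquiv,
    fun x y => (Fintype.orderIsoFinOfCardEq α hn).symm.lt_iff_lt⟩

theorem mem_iff_lt_card_of_isLowerSet {α : Type*} [Fintype α] {n : ℕ} (e : α ≃ Fin n)
    (U : Finset α) (hU : ∀ x y, y ∈ U → e x < e y → x ∈ U) (x : α) :
    x ∈ U ↔ (e x : ℕ) < U.card := by
  constructor
  · intro hx
    have h : (Finset.Iic (e x)).map e.symm.toEmbedding ⊆ U := by
      intro y hy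
      simp only [Finset.mem_map_equiv, Equiv.symm_symm, Finset.mem_Iic] at hy
      rcases hy.lt_or_eq with h | h
      · exact hU y x hx h
      · rwa [e.injective h]
    simpa using Finset.card_le_card h
  · intro hx
    by_contra hxU
    have h : U ⊆ (Finset.Iio (e x)).map e.symm.toEmbedding := by
      intro y hy
      simp only [Finset.mem_map_equiv, Equiv.symm_symm, Finset.mem_Iio]
      by_contra hlt
      rcases (not_lt.1 hlt).lt_or_eq with h | h
      · exact hxU (hU x y hy h)
      · exact hxU (e.injective h ▸ hy)
    have := Finset.card_le_card h
    simp at this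
    omega

theorem le_card_filter_iff {α : Type*} [Fintype α] {n : ℕ} {e : α ≃ Fin n} {g : α → ℕ}
    (hg : ∀ x y, g x < g y → e x < e y) (k : ℕ) (x : α) :
    (Finset.univ.filter fun y => g y < k).card ≤ (e x : ℕ) ↔ k ≤ g x := by
  have := mem_iff_lt_card_of_isLowerSet e (Finset.univ.filter fun y => g y < k)
    (fun x y hy hxy => by
      simp only [Finset.mem_filter, Finset.mem_univ, true_and] at hy ⊢
      by_contra h
      exact (hg y x (by omega)).asymm hxy) x
  simp only [Finset.mem_filter, Finset.mem_univ, true_and] at this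
  omega

/-- A filling of an infinite staircase whose `i`-th `C`-cell has `a i` entries and whose `i`-th
`D`-cell has `b i` entries: the contents of the cells, together with the vertical interleaving of
the two cells of each row and the horizontal interleaving of the two cells of each column. -/
structure StairFilling (a b : ℕ → ℕ) where
  cPerm : ∀ i, Perm (a i)
  dPerm : ∀ i, Perm (b i)
  rowShuffle : ∀ i, Shuffle (a i) (b i)
  colShuffle : ∀ i, Shuffle (b i) (a (i + 1))

/-- The entries in the first `2 * (t + 1)` cells of a staircase. -/
abbrev StairPoint (a b : ℕ → ℕ) (t : ℕ) : Type := Σ i : Fin (t + 1), Fin (a i) ⊕ Fin (b i)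

/-- The index of the cell containing a given entry. -/
def cellIndex {a b : ℕ → ℕ} {t : ℕ} : StairPoint a b t → ℕ
  | ⟨i, Sum.inl _⟩ => 2 * i
  | ⟨i, Sum.inr _⟩ => 2 * i + 1

namespace StairFilling

variable {a b : ℕ → ℕ} {t n : ℕ} (S : StaircaseData) (ω ω' : StairFilling a b)

/-- The relative horizontal position of an entry within its column. -/
def colKey : (i : ℕ) → Fin (a i) ⊕ Fin (b i) → ℕ
  | 0, Sum.inl x => x
  | i + 1, Sum.inl x => (ω.colShuffle i).1 (Sum.inr x)
  | i, Sum.inr y => (ω.colShuffle i).1 (Sum.inl y)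

/-- The relative vertical position of an entry within its row. -/
def rowKey (i : ℕ) : Fin (a i) ⊕ Fin (b i) → ℕ
  | Sum.inl x => (ω.rowShuffle i).1 (Sum.inl (ω.cPerm i x))
  | Sum.inr y => (ω.rowShuffle i).1 (Sum.inr (ω.dPerm i y))

theorem colKey_inr (i : ℕ) (y : Fin (b i)) :
    ω.colKey i (Sum.inr y) = (ω.colShuffle i).1 (Sum.inl y) := by
  cases i <;> rfl

theorem colKey_inl_strictMono (i : ℕ) : StrictMono fun x => ω.colKey i (Sum.inl x) := by
  cases i with
  | zero => exact fun x y h => h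
  | succ i => exact (ω.colShuffle i).2.2

theorem colKey_inr_strictMono (i : ℕ) : StrictMono fun x => ω.colKey i (Sum.inr x) := by
  simp only [colKey_inr]
  exact (ω.colShuffle i).2.1

/-- The horizontal position of an entry. -/
def colLex (p : StairPoint a b t) : ℕ ×ₗ ℕ :=
  toLex ((S.pos (cellIndex p)).1, ω.colKey p.1 p.2)

/-- The vertical position of an entry. -/
def rowLex (p : StairPoint a b t) : ℕ ×ₗ ℕ :=
  toLex ((S.pos (cellIndex p)).2, ω.rowKey p.1 p.2)

theorem colLex_injective : Function.Injective (ω.colLex S (t := t)) := by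
  rintro ⟨i, p⟩ ⟨j, q⟩ h
  simp only [colLex, EmbeddingLike.apply_eq_iff_eq, Prod.mk.injEq] at h
  obtain ⟨h, hk⟩ := h
  have h' := S.colOnly _ _ h
  have key (i j : Fin (t + 1)) (x : Fin (a i)) (y : Fin (b j))
      (h' : (2 * (i : ℕ) + 1) / 2 = (2 * (j : ℕ) + 1 + 1) / 2)
      (hk : ω.colKey i (Sum.inl x) = ω.colKey j (Sum.inr y)) : False := by
    obtain ⟨i, hi⟩ := i
    obtain rfl : i = j + 1 := by simp at h'; omega
    rw [colKey_inr] at hk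
    simp [colKey, Fin.val_inj] at hk
  rcases p with x | x <;> rcases q with y | y <;> simp only [cellIndex] at h'
  · obtain rfl : i = j := by omega
    rw [(ω.colKey_inl_strictMono i).injective hk]
  · exact (key i j x y h' hk).elim
  · exact (key j i y x h'.symm hk.symm).elim
  · obtain rfl : i = j := by omega
    rw [(ω.colKey_inr_strictMono i).injective hk]

theorem rowLex_injective : Function.Injective (ω.rowLex S (t := t)) := by
  rintro ⟨i, p⟩ ⟨j, q⟩ h
  simp only [rowLex, EmbeddingLike.apply_eq_iff_eq, Prod.mk.injEq] at h
  obtain ⟨h, hk⟩ := h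
  have h' := S.rowOnly _ _ h
  obtain rfl : i = j := by
    rcases p with x | x <;> rcases q with y | y <;> simp only [cellIndex] at h' <;> omega
  rcases p with x | x <;> rcases q with y | y <;> simp_all [rowKey, Fin.val_inj]

variable (hn : Fintype.card (StairPoint a b t) = n)

/-- The numbering of the entries from left to right. -/
noncomputable def colEquiv : StairPoint a b t ≃ Fin n :=
  (exists_equiv_fin_lt_iff hn (ω.colLex_injective S)).choose

/-- The numbering of the entries from bottom to top. -/
noncomputable def rowEquiv : StairPoint a b t ≃ Fin n :=
  (exists_equiv_fin_lt_iff hn (ω.rowLex_injective S)).choose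

theorem colEquiv_lt_iff (p q : StairPoint a b t) :
    ω.colEquiv S hn p < ω.colEquiv S hn q ↔ ω.colLex S p < ω.colLex S q :=
  (exists_equiv_fin_lt_iff hn (ω.colLex_injective S)).choose_spec p q

theorem rowEquiv_lt_iff (p q : StairPoint a b t) :
    ω.rowEquiv S hn p < ω.rowEquiv S hn q ↔ ω.rowLex S p < ω.rowLex S q :=
  (exists_equiv_fin_lt_iff hn (ω.rowLex_injective S)).choose_spec p q

/-- The permutation obtained by filling a staircase. -/
noncomputable def toPerm : Perm n := (ω.colEquiv S hn).symm.trans (ω.rowEquiv S hn)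

theorem toPerm_colEquiv (p : StairPoint a b t) :
    ω.toPerm S hn (ω.colEquiv S hn p) = ω.rowEquiv S hn p := by
  simp [toPerm]

/-- The number of entries to the left of column `k`. -/
def colDiv (a b : ℕ → ℕ) (t k : ℕ) : ℕ :=
  (Finset.univ.filter fun p : StairPoint a b t => (S.pos (cellIndex p)).1 < k).card

/-- The number of entries below row `k`. -/
def rowDiv (a b : ℕ → ℕ) (t k : ℕ) : ℕ :=
  (Finset.univ.filter fun p : StairPoint a b t => (S.pos (cellIndex p)).2 < k).card

theorem colDiv_le_iff (k : ℕ) (p : StairPoint a b t) :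
    colDiv S a b t k ≤ (ω.colEquiv S hn p : ℕ) ↔ k ≤ (S.pos (cellIndex p)).1 :=
  le_card_filter_iff (fun p q h => (ω.colEquiv_lt_iff S hn p q).2
    (Prod.Lex.toLex_lt_toLex.2 (Or.inl h))) k p

theorem rowDiv_le_iff (k : ℕ) (p : StairPoint a b t) :
    rowDiv S a b t k ≤ (ω.rowEquiv S hn p : ℕ) ↔ k ≤ (S.pos (cellIndex p)).2 :=
  le_card_filter_iff (fun p q h => (ω.rowEquiv_lt_iff S hn p q).2
    (Prod.Lex.toLex_lt_toLex.2 (Or.inl h))) k p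

theorem colEquiv_mem_cellSet (k l : ℕ) (p : StairPoint a b t) :
    ω.colEquiv S hn p ∈ cellSet (ω.toPerm S hn) (colDiv S a b t) (rowDiv S a b t) k l ↔
      S.pos (cellIndex p) = (k, l) := by
  simp only [cellSet, Set.mem_ofPred_eq, toPerm_colEquiv, ← not_le, colDiv_le_iff, rowDiv_le_iff,
    Prod.ext_iff]
  omega

theorem range_colEquiv_inl (i : Fin (t + 1)) :
    Set.range (fun x => ω.colEquiv S hn ⟨i, Sum.inl x⟩) =
      cellSet (ω.toPerm S hn) (colDiv S a b t) (rowDiv S a b t)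
        (S.pos (2 * i)).1 (S.pos (2 * i)).2 := by
  ext z
  obtain ⟨⟨j, p⟩, rfl⟩ := (ω.colEquiv S hn).surjective z
  rw [colEquiv_mem_cellSet, Prod.mk.eta, S.inj.eq_iff]
  simp only [Set.mem_range, EmbeddingLike.apply_eq_iff_eq]
  constructor
  · rintro ⟨x, hx⟩
    rw [← hx]; rfl
  · intro h
    rcases p with x | x <;> simp only [cellIndex] at h
    · obtain rfl : j = i := by omega
      exact ⟨x, rfl⟩
    · omega

theorem range_colEquiv_inr (i : Fin (t + 1)) :
    Set.range (fun x => ω.colEquiv S hn ⟨i, Sum.inr x⟩) =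
      cellSet (ω.toPerm S hn) (colDiv S a b t) (rowDiv S a b t)
        (S.pos (2 * i + 1)).1 (S.pos (2 * i + 1)).2 := by
  ext z
  obtain ⟨⟨j, p⟩, rfl⟩ := (ω.colEquiv S hn).surjective z
  rw [colEquiv_mem_cellSet, Prod.mk.eta, S.inj.eq_iff]
  simp only [Set.mem_range, EmbeddingLike.apply_eq_iff_eq]
  constructor
  · rintro ⟨x, hx⟩
    rw [← hx]; rfl
  · intro h
    rcases p with x | x <;> simp only [cellIndex] at h
    · omega
    · obtain rfl : j = i := by omega
      exact ⟨x, rfl⟩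

theorem colEquiv_inl_strictMono (i : Fin (t + 1)) :
    StrictMono fun x => ω.colEquiv S hn ⟨i, Sum.inl x⟩ := fun _ _ h =>
  (ω.colEquiv_lt_iff S hn _ _).2
    (Prod.Lex.toLex_lt_toLex.2 (Or.inr ⟨rfl, ω.colKey_inl_strictMono i h⟩))

theorem colEquiv_inr_strictMono (i : Fin (t + 1)) :
    StrictMono fun x => ω.colEquiv S hn ⟨i, Sum.inr x⟩ := fun _ _ h =>
  (ω.colEquiv_lt_iff S hn _ _).2
    (Prod.Lex.toLex_lt_toLex.2 (Or.inr ⟨rfl, ω.colKey_inr_strictMono i h⟩))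

theorem rowEquiv_lt_iff_rowKey (i : Fin (t + 1)) (p q : Fin (a i) ⊕ Fin (b i)) :
    ω.rowEquiv S hn ⟨i, p⟩ < ω.rowEquiv S hn ⟨i, q⟩ ↔ ω.rowKey i p < ω.rowKey i q := by
  have : (S.pos (cellIndex (⟨i, p⟩ : StairPoint a b t))).2 =
      (S.pos (cellIndex (⟨i, q⟩ : StairPoint a b t))).2 := by
    rcases p with x | x <;> rcases q with y | y <;> simp [cellIndex, S.rowEq]
  simp [rowEquiv_lt_iff, rowLex, Prod.Lex.toLex_lt_toLex, this]

theorem rowEquiv_inl_lt_iff (i : Fin (t + 1)) (x y : Fin (a i)) :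
    ω.rowEquiv S hn ⟨i, Sum.inl x⟩ < ω.rowEquiv S hn ⟨i, Sum.inl y⟩ ↔
      ω.cPerm i x < ω.cPerm i y :=
  (ω.rowEquiv_lt_iff_rowKey S hn i _ _).trans (ω.rowShuffle i).2.1.lt_iff_lt

theorem rowEquiv_inr_lt_iff (i : Fin (t + 1)) (x y : Fin (b i)) :
    ω.rowEquiv S hn ⟨i, Sum.inr x⟩ < ω.rowEquiv S hn ⟨i, Sum.inr y⟩ ↔
      ω.dPerm i x < ω.dPerm i y :=
  (ω.rowEquiv_lt_iff_rowKey S hn i _ _).trans (ω.rowShuffle i).2.2.lt_iff_lt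

theorem toPerm_mem_gridSet {C D : ∀ m, Set (Perm m)}
    (hC : ∀ i ≤ t, a i = 0 ∨ ω.cPerm i ∈ C (a i)) (hD : ∀ i ≤ t, b i = 0 ∨ ω.dPerm i ∈ D (b i)) :
    ω.toPerm S hn ∈ gridSet (S.M C D) n := by
  classical
  have hle (U : Finset (StairPoint a b t)) : U.card ≤ n := hn ▸ Finset.card_le_univ U
  have hfull (g : StairPoint a b t → ℕ) :
      ∃ k, (Finset.univ.filter fun p => g p < k).card = n := by
    refine ⟨(Finset.univ.sup g) + 1, ?_⟩
    rw [Finset.filter_true_of_mem, Finset.card_univ, hn]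
    exact fun p hp => Nat.lt_succ_of_le (Finset.le_sup hp)
  refine ⟨colDiv S a b t, rowDiv S a b t, ?_, ?_, ?_, ?_, fun k => hle _, fun k => hle _,
    hfull _, hfull _, fun k l => ?_⟩
  · exact fun k l h => Finset.card_le_card
      (Finset.monotone_filter_right _ fun p _ hp => hp.trans_le h)
  · exact fun k l h => Finset.card_le_card
      (Finset.monotone_filter_right _ fun p _ hp => hp.trans_le h)
  · simp [colDiv]
  · simp [rowDiv]
  refine (Set.eq_empty_or_nonempty _).imp_right ?_
  rintro ⟨z, hz⟩
  obtain ⟨⟨i, p⟩, rfl⟩ := (ω.colEquiv S hn).surjective z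
  rw [colEquiv_mem_cellSet] at hz
  rcases p with x | x <;> simp only [cellIndex] at hz
  · have hM : S.M C D k l = C := if_pos ⟨i, hz⟩
    refine ⟨a i, ω.cPerm i, OrderEmbedding.ofStrictMono _ (ω.colEquiv_inl_strictMono S hn i),
      ?_, fun x y => ?_, ?_⟩
    · have := ω.range_colEquiv_inl S hn i
      rwa [hz] at this
    · simp only [OrderEmbedding.coe_ofStrictMono, toPerm_colEquiv, rowEquiv_inl_lt_iff]
    · rw [hM]
      exact (hC i (by omega)).resolve_left (Fin.pos x).ne'
  · have hM : S.M C D k l = D := by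
      refine (if_neg ?_).trans (if_pos ⟨i, hz⟩)
      rintro ⟨j, hj⟩
      have := S.inj (hj.trans hz.symm)
      omega
    refine ⟨b i, ω.dPerm i, OrderEmbedding.ofStrictMono _ (ω.colEquiv_inr_strictMono S hn i),
      ?_, fun x y => ?_, ?_⟩
    · have := ω.range_colEquiv_inr S hn i
      rwa [hz] at this
    · simp only [OrderEmbedding.coe_ofStrictMono, toPerm_colEquiv, rowEquiv_inr_lt_iff]
    · rw [hM]
      exact (hD i (by omega)).resolve_left (Fin.pos x).ne'

variable {ω ω'}

theorem colEquiv_eq_of_toPerm_eq (h : ω.toPerm S hn = ω'.toPerm S hn) :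
    ω.colEquiv S hn = ω'.colEquiv S hn := by
  ext1 ⟨i, p⟩
  rcases p with x | x
  · refine congrFun (StrictMono.range_inj (ω.colEquiv_inl_strictMono S hn i)
      (ω'.colEquiv_inl_strictMono S hn i) |>.1 ?_) x
    rw [range_colEquiv_inl, range_colEquiv_inl, h]
  · refine congrFun (StrictMono.range_inj (ω.colEquiv_inr_strictMono S hn i)
      (ω'.colEquiv_inr_strictMono S hn i) |>.1 ?_) x
    rw [range_colEquiv_inr, range_colEquiv_inr, h]

theorem rowEquiv_eq_of_toPerm_eq (h : ω.toPerm S hn = ω'.toPerm S hn) :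
    ω.rowEquiv S hn = ω'.rowEquiv S hn := by
  ext1 p
  rw [← toPerm_colEquiv, ← toPerm_colEquiv, h, colEquiv_eq_of_toPerm_eq S hn h]

theorem cPerm_eq_of_toPerm_eq (h : ω.toPerm S hn = ω'.toPerm S hn) {i : ℕ} (hi : i ≤ t) :
    ω.cPerm i = ω'.cPerm i :=
  equiv_fin_eq_of_lt_iff_lt fun x y => by
    have := ω.rowEquiv_inl_lt_iff S hn ⟨i, by omega⟩ x y
    rw [rowEquiv_eq_of_toPerm_eq S hn h, rowEquiv_inl_lt_iff] at this
    exact this.symm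

theorem dPerm_eq_of_toPerm_eq (h : ω.toPerm S hn = ω'.toPerm S hn) {i : ℕ} (hi : i ≤ t) :
    ω.dPerm i = ω'.dPerm i :=
  equiv_fin_eq_of_lt_iff_lt fun x y => by
    have := ω.rowEquiv_inr_lt_iff S hn ⟨i, by omega⟩ x y
    rw [rowEquiv_eq_of_toPerm_eq S hn h, rowEquiv_inr_lt_iff] at this
    exact this.symm

theorem rowShuffle_eq_of_toPerm_eq (h : ω.toPerm S hn = ω'.toPerm S hn) {i : ℕ} (hi : i ≤ t) :
    ω.rowShuffle i = ω'.rowShuffle i := by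
  have key (ω : StairFilling a b) (p : Fin (a i) ⊕ Fin (b i)) :
      ω.rowKey i p = (ω.rowShuffle i).1 (Equiv.sumCongr (ω.cPerm i) (ω.dPerm i) p) := by
    rcases p <;> rfl
  have heq : (Equiv.sumCongr (ω.cPerm i) (ω.dPerm i)).trans (ω.rowShuffle i).1 =
      (Equiv.sumCongr (ω'.cPerm i) (ω'.dPerm i)).trans (ω'.rowShuffle i).1 :=
    equiv_fin_eq_of_lt_iff_lt fun p q => by
      have := ω.rowEquiv_lt_iff_rowKey S hn ⟨i, by omega⟩ p q
      rw [rowEquiv_eq_of_toPerm_eq S hn h, rowEquiv_lt_iff_rowKey, key, key, key, key] at this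
      exact this.symm
  rw [cPerm_eq_of_toPerm_eq S hn h hi, dPerm_eq_of_toPerm_eq S hn h hi] at heq
  refine Subtype.ext (Equiv.ext fun p => ?_)
  simpa using Equiv.congr_fun heq ((Equiv.sumCongr (ω'.cPerm i) (ω'.dPerm i)).symm p)

theorem colShuffle_eq_of_toPerm_eq (h : ω.toPerm S hn = ω'.toPerm S hn) {i : ℕ} (hi : i < t) :
    ω.colShuffle i = ω'.colShuffle i := by
  let pt : Fin (b i) ⊕ Fin (a (i + 1)) → StairPoint a b t :=
    Sum.elim (fun y => ⟨⟨i, by omega⟩, Sum.inr y⟩) (fun x => ⟨⟨i + 1, by omega⟩, Sum.inl x⟩)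
  have key (ω : StairFilling a b) (p) :
      ω.colLex S (pt p) = toLex ((S.pos (2 * i + 1)).1, ((ω.colShuffle i).1 p : ℕ)) := by
    rcases p with y | x
    · simp [pt, colLex, cellIndex, colKey_inr]
    · simp [pt, colLex, cellIndex, colKey, ← S.colEq, mul_add]
  refine Subtype.ext (equiv_fin_eq_of_lt_iff_lt fun p q => ?_)
  have := ω.colEquiv_lt_iff S hn (pt p) (pt q)
  rw [colEquiv_eq_of_toPerm_eq S hn h, colEquiv_lt_iff, key, key, key, key] at this
  simpa [Prod.Lex.toLex_lt_toLex] using this.symm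

end StairFilling

theorem prod_le_ncard_gridSet (S : StaircaseData) {C D C₀ D₀ : ∀ m, Set (Perm m)}
    (hC : ∀ m ≠ 0, C₀ m ⊆ C m) (hD : ∀ m ≠ 0, D₀ m ⊆ D m) (a b : ℕ → ℕ) (t : ℕ) :
    (∏ i ∈ Finset.range (t + 1),
        (C₀ (a i)).ncard * (D₀ (b i)).ncard * (a i + b i).choose (a i)) *
      ∏ i ∈ Finset.range t, (b i + a (i + 1)).choose (b i) ≤
    (gridSet (S.M C D) (∑ i ∈ Finset.range (t + 1), (a i + b i))).ncard := by
  have hn : Fintype.card (StairPoint a b t) = ∑ i ∈ Finset.range (t + 1), (a i + b i) := by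
    simp [StairPoint, Finset.sum_range]
  let Ω : Type := (∀ i : Fin (t + 1), C₀ (a i)) × (∀ i : Fin (t + 1), D₀ (b i)) ×
    (∀ i : Fin (t + 1), Shuffle (a i) (b i)) × (∀ i : Fin t, Shuffle (b i) (a (i + 1)))
  let fill (d : Ω) : StairFilling a b :=
    { cPerm := fun i => if h : i < t + 1 then (d.1 ⟨i, h⟩).1 else 1
      dPerm := fun i => if h : i < t + 1 then (d.2.1 ⟨i, h⟩).1 else 1
      rowShuffle := fun i => if h : i < t + 1 then d.2.2.1 ⟨i, h⟩ else default
      colShuffle := fun i => if h : i < t then d.2.2.2 ⟨i, h⟩ else default }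
  let f (d : Ω) : gridSet (S.M C D) (∑ i ∈ Finset.range (t + 1), (a i + b i)) :=
    ⟨(fill d).toPerm S hn, (fill d).toPerm_mem_gridSet S hn
      (fun i hi => by
        simp only [fill, dif_pos (Nat.lt_succ_of_le hi)]
        exact or_iff_not_imp_left.2 fun h => hC _ h (d.1 ⟨i, Nat.lt_succ_of_le hi⟩).2)
      (fun i hi => by
        simp only [fill, dif_pos (Nat.lt_succ_of_le hi)]
        exact or_iff_not_imp_left.2 fun h => hD _ h (d.2.1 ⟨i, Nat.lt_succ_of_le hi⟩).2)⟩
  have hf : Function.Injective f := fun d d' h => by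
    have h' : (fill d).toPerm S hn = (fill d').toPerm S hn := congrArg Subtype.val h
    refine Prod.ext (funext fun i => Subtype.ext ?_) (Prod.ext (funext fun i => Subtype.ext ?_)
      (Prod.ext (funext fun i => ?_) (funext fun i => ?_)))
    · have hi := Nat.le_of_lt_succ i.2
      simpa [fill, hi] using StairFilling.cPerm_eq_of_toPerm_eq S hn h' hi
    · have hi := Nat.le_of_lt_succ i.2
      simpa [fill, hi] using StairFilling.dPerm_eq_of_toPerm_eq S hn h' hi
    · have hi := Nat.le_of_lt_succ i.2
      simpa [fill, hi] using StairFilling.rowShuffle_eq_of_toPerm_eq S hn h' hi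
    · simpa [fill] using StairFilling.colShuffle_eq_of_toPerm_eq S hn h' i.2
  rw [← Nat.card_coe_set_eq]
  refine le_trans ?_ (Nat.card_le_card_of_injective f hf)
  simp only [Ω, Nat.card_prod, Nat.card_pi, Nat.card_coe_set_eq, Finset.prod_range,
    Finset.prod_mul_distrib, mul_assoc]
  gcongr
  · exact choose_le_card_shuffle _ _
  · exact choose_le_card_shuffle _ _

theorem pow_mul_le_ncard_gridSet (S : StaircaseData) {C D C₀ D₀ : ∀ m, Set (Perm m)}
    (hC : ∀ m ≠ 0, C₀ m ⊆ C m) (hD : ∀ m ≠ 0, D₀ m ⊆ D m) (a b r t : ℕ) :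
    ((C₀ a).ncard * (D₀ b).ncard * (a + b).choose a ^ 2) ^ t * ((C₀ a).ncard * (D₀ r).ncard) ≤
    (gridSet (S.M C D) (t * (a + b) + (a + r))).ncard := by
  have h := prod_le_ncard_gridSet S hC hD (fun _ => a) (fun i => if i < t then b else r) t
  have hsum : ∑ i ∈ Finset.range (t + 1), (a + if i < t then b else r) =
      t * (a + b) + (a + r) := by
    rw [Finset.sum_range_succ, Finset.sum_congr rfl (g := fun _ => a + b)]
    · simp
    · exact fun i hi => by rw [if_pos (Finset.mem_range.1 hi)]
  rw [hsum] at h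
  refine le_trans ?_ h
  have hcell : ∏ i ∈ Finset.range t, ((C₀ a).ncard * (D₀ (if i < t then b else r)).ncard *
      (a + if i < t then b else r).choose a) =
      ((C₀ a).ncard * (D₀ b).ncard * (a + b).choose a) ^ t := by
    rw [← Finset.card_range t, ← Finset.prod_const, Finset.card_range]
    exact Finset.prod_congr rfl fun i hi => by rw [if_pos (Finset.mem_range.1 hi)]
  have hcol : ∏ i ∈ Finset.range t, ((if i < t then b else r) + a).choose
      (if i < t then b else r) = (a + b).choose a ^ t := by
    rw [← Finset.card_range t, ← Finset.prod_const, Finset.card_range]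
    exact Finset.prod_congr rfl fun i hi => by
      rw [if_pos (Finset.mem_range.1 hi), add_comm b a, Nat.choose_symm_add]
  have hpos : 1 ≤ (a + r).choose a := Nat.choose_pos (Nat.le_add_right _ _)
  rw [Finset.prod_range_succ, hcell, hcol, if_neg (lt_irrefl t)]
  calc _ = ((C₀ a).ncard * (D₀ b).ncard * (a + b).choose a) ^ t *
        ((C₀ a).ncard * (D₀ r).ncard * 1) * (a + b).choose a ^ t := by ring
    _ ≤ _ := by gcongr

theorem mul_le_ncard_gridSet (S : StaircaseData) {C D C₀ D₀ : ∀ m, Set (Perm m)}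
    (hC : ∀ m ≠ 0, C₀ m ⊆ C m) (hD : ∀ m ≠ 0, D₀ m ⊆ D m) (a r : ℕ) :
    (C₀ a).ncard * (D₀ r).ncard ≤ (gridSet (S.M C D) (a + r)).ncard := by
  have h := pow_mul_le_ncard_gridSet S hC hD a 0 r 0
  rwa [zero_mul, zero_add, pow_zero, one_mul] at h

theorem ncard_left_le_ncard_gridSet (S : StaircaseData) (C D : ∀ m, Set (Perm m)) (n : ℕ) :
    (C n).ncard ≤ (gridSet (S.M C D) n).ncard := by
  simpa [emptyCell] using mul_le_ncard_gridSet S (C := C) (D := D) (C₀ := C) (D₀ := emptyCell)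
    (fun _ _ => subset_rfl) (fun m hm => by simp [emptyCell, hm]) n 0

theorem ncard_right_le_ncard_gridSet (S : StaircaseData) (C D : ∀ m, Set (Perm m)) (n : ℕ) :
    (D n).ncard ≤ (gridSet (S.M C D) n).ncard := by
  have h := mul_le_ncard_gridSet S (C := C) (D := D) (C₀ := emptyCell) (D₀ := D)
    (fun m hm => by simp [emptyCell, hm]) (fun _ _ => subset_rfl) 0 n
  rw [zero_add] at h
  simpa [emptyCell] using h

theorem eventually_pow_le_ncard {F : ∀ m, Set (Perm m)} {g L : ℝ} (hF : HasGrowth F g)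
    (hL : 0 < L) (hLg : L < g) : ∀ᶠ n in atTop, L ^ n ≤ ((F n).ncard : ℝ) := by
  filter_upwards [hF.eventually_const_lt hLg, eventually_gt_atTop 0] with n hn hn0
  calc L ^ n ≤ growthSeq F n ^ n := pow_le_pow_left₀ hL.le hn.le n
    _ = (F n).ncard := Real.rpow_inv_natCast_pow (Nat.cast_nonneg _) hn0.ne'

theorem PermClass.nonempty_of_hasGrowth (C : PermClass) {g : ℝ} (hC : HasGrowth C.mem g)
    (hg : 0 < g) (k : ℕ) : (C.mem k).Nonempty := by
  obtain ⟨n, hn, hkn⟩ := ((eventually_pow_le_ncard hC (half_pos hg) (half_lt_self hg)).and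
    (eventually_ge_atTop k)).exists
  have hpos : (0 : ℝ) < (C.mem n).ncard := (pow_pos (half_pos hg) n).trans_le hn
  obtain ⟨π, hπ⟩ := Set.nonempty_of_ncard_ne_zero (Nat.cast_pos.1 hpos).ne'
  let ι : Fin k ↪o Fin n := Fin.castLEOrderEmb hkn
  obtain ⟨e, he⟩ := exists_equiv_fin_lt_iff (Fintype.card_fin k) (π.injective.comp ι.injective)
  exact ⟨e, C.closed e π hπ ⟨ι, he⟩⟩

theorem exists_pos_mul_pow_le_ncard {F : ∀ m, Set (Perm m)} {g L : ℝ} (hF : HasGrowth F g)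
    (hne : ∀ k, (F k).Nonempty) (hL : 0 < L) (hLg : L < g) :
    ∃ κ > 0, ∀ k, κ * L ^ k ≤ ((F k).ncard : ℝ) := by
  obtain ⟨N, hN⟩ := eventually_atTop.1 (eventually_pow_le_ncard hF hL hLg)
  have h1 : 1 ≤ (1 + L) ^ N := one_le_pow₀ (by linarith)
  refine ⟨((1 + L) ^ N)⁻¹, by positivity, fun k => ?_⟩
  rcases le_total N k with hk | hk
  · exact (mul_le_of_le_one_left (by positivity) (inv_le_one_of_one_le₀ h1)).trans (hN k hk)
  · have hcard : (1 : ℝ) ≤ (F k).ncard := by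
      exact_mod_cast (Set.ncard_pos).2 (hne k)
    refine le_trans ?_ hcard
    rw [inv_mul_le_one₀ (by positivity)]
    exact (pow_le_pow_left₀ hL.le (by linarith) k).trans (pow_le_pow_right₀ (by linarith) hk)

theorem ofReal_le_lgr {F : ∀ m, Set (Perm m)} {g : ℝ}
    (h : ∀ L, 0 < L → L < g → ∀ᶠ n in atTop, L ^ n ≤ ((F n).ncard : ℝ)) :
    ENNReal.ofReal g ≤ lgr F := by
  refine ENNReal.le_of_forall_nnreal_lt fun L hL => ?_
  rcases eq_or_ne L 0 with rfl | hL0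
  · simp
  have hLg : (L : ℝ) < g := by
    rw [← ENNReal.ofReal_coe_nnreal] at hL
    exact (ENNReal.ofReal_lt_ofReal_iff_of_nonneg L.coe_nonneg).1 hL
  refine le_liminf_of_le (by isBoundedDefault) ?_
  filter_upwards [h L (NNReal.coe_pos.2 (pos_iff_ne_zero.2 hL0)) hLg, eventually_gt_atTop 0]
    with n hn hn0
  have hn' : (L : ℝ≥0∞) ^ n ≤ ((F n).ncard : ℝ≥0∞) := by exact_mod_cast hn
  calc (L : ℝ≥0∞) = ((L : ℝ≥0∞) ^ n) ^ ((n : ℝ)⁻¹) := (ENNReal.pow_rpow_inv_natCast hn0.ne' _).symm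
    _ ≤ _ := ENNReal.rpow_le_rpow hn' (by positivity)

theorem exists_add_pow_le_mul_choose {x y : ℝ} (m : ℕ) :
    ∃ a b, a + b = m ∧ (x + y) ^ m ≤ (m + 1) * (x ^ a * y ^ b * m.choose a) := by
  obtain ⟨a, ha, h⟩ := Finset.exists_le_of_sum_le (s := Finset.range (m + 1))
    (f := fun _ => (x + y) ^ m / (m + 1)) (g := fun a => x ^ a * y ^ (m - a) * m.choose a)
    ⟨0, by simp⟩ (by rw [← add_pow]; simp [mul_div_cancel₀, Nat.cast_add_one_ne_zero])
  refine ⟨a, m - a, by have := Finset.mem_range.1 ha; omega, ?_⟩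
  rwa [div_le_iff₀' (by positivity)] at h

theorem exists_mul_sq_mul_pow_lt {L M κ : ℝ} (hL : 0 < L) (hLM : L < M) (hκ : 0 < κ) :
    ∃ m : ℕ, 0 < m ∧ ((m : ℝ) + 1) ^ 2 * L ^ m < κ * M ^ m := by
  have hM : 0 < M := hL.trans hLM
  have hlim := (tendsto_pow_const_mul_const_pow_of_abs_lt_one 2 (r := L / M)
    (by rw [abs_of_pos (by positivity), div_lt_one hM]; exact hLM)).comp (tendsto_add_atTop_nat 1)
  obtain ⟨m, hm, hm0⟩ := ((hlim.eventually_lt_const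
    (show 0 < κ * (L / M) by positivity)).and (eventually_gt_atTop 0)).exists
  refine ⟨m, hm0, ?_⟩
  have h : ((m : ℝ) + 1) ^ 2 * (L / M) ^ m < κ := by
    refine lt_of_mul_lt_mul_right ?_ (show 0 ≤ L / M by positivity)
    simpa [pow_succ, mul_assoc] using hm
  rwa [div_pow, mul_div_assoc', div_lt_iff₀ (by positivity)] at h

theorem exists_pow_lt_ncard_mul {F G : ∀ m, Set (Perm m)} {g h L : ℝ} (hF : HasGrowth F g)
    (hG : HasGrowth G h) (hFne : ∀ k, (F k).Nonempty) (hGne : ∀ k, (G k).Nonempty)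
    (hg : 0 < g) (hh : 0 < h) (hL : 0 < L) (hLgh : L < (√g + √h) ^ 2) :
    ∃ a b, 0 < a + b ∧
      L ^ (a + b) < ((F a).ncard : ℝ) * (G b).ncard * (a + b).choose a ^ 2 := by
  have hg' := Real.sqrt_pos.2 hg
  have hh' := Real.sqrt_pos.2 hh
  obtain ⟨c, hc, hc1⟩ := exists_between
    (show √L / (√g + √h) < 1 by
      rw [div_lt_one (by positivity)]; exact (Real.sqrt_lt' (by positivity)).2 hLgh)
  have hc0 : 0 < c := lt_of_le_of_lt (by positivity) hc
  rw [div_lt_iff₀ (by positivity), Real.sqrt_lt' (by positivity)] at hc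
  have hlt {g : ℝ} (hg : 0 < g) : (c * √g) ^ 2 < g := by
    rw [mul_pow, Real.sq_sqrt hg.le]
    exact mul_lt_of_lt_one_left hg (pow_lt_one₀ hc0.le hc1 two_ne_zero)
  obtain ⟨κ, hκ, hFκ⟩ := exists_pos_mul_pow_le_ncard hF hFne (by positivity) (hlt hg)
  obtain ⟨μ, hμ, hGμ⟩ := exists_pos_mul_pow_le_ncard hG hGne (by positivity) (hlt hh)
  obtain ⟨m, hm0, hm⟩ := exists_mul_sq_mul_pow_lt hL hc (mul_pos hκ hμ)
  obtain ⟨a, b, rfl, hab⟩ := exists_add_pow_le_mul_choose (x := c * √g) (y := c * √h) m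
  refine ⟨a, b, hm0, ?_⟩
  refine lt_of_mul_lt_mul_left (a := (((a + b : ℕ) : ℝ) + 1) ^ 2) ?_ (by positivity)
  calc _ < κ * μ * ((c * (√g + √h)) ^ 2) ^ (a + b) := hm
    _ = κ * μ * ((c * √g + c * √h) ^ (a + b)) ^ 2 := by rw [← mul_add, pow_right_comm]
    _ ≤ κ * μ * ((((a + b : ℕ) : ℝ) + 1) *
          ((c * √g) ^ a * (c * √h) ^ b * (a + b).choose a)) ^ 2 := by gcongr
    _ = (((a + b : ℕ) : ℝ) + 1) ^ 2 * ((κ * ((c * √g) ^ 2) ^ a) * (μ * ((c * √h) ^ 2) ^ b) *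
          (a + b).choose a ^ 2) := by ring
    _ ≤ _ := by
      gcongr
      · exact hFκ a
      · exact hGμ b

theorem eventually_pow_le_ncard_gridSet (S : StaircaseData) {C D : ∀ m, Set (Perm m)}
    (hC : ∀ k, (C k).Nonempty) (hD : ∀ k, (D k).Nonempty) {a b : ℕ} (hab : 0 < a + b) {L : ℝ}
    (hL : 0 < L)
    (h : L ^ (a + b) < ((C a).ncard : ℝ) * (D b).ncard * (a + b).choose a ^ 2) :
    ∀ᶠ n in atTop, L ^ n ≤ ((gridSet (S.M C D) n).ncard : ℝ) := by
  set Q : ℝ := ((C a).ncard : ℝ) * (D b).ncard * (a + b).choose a ^ 2 with hQ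
  have htop : Tendsto (fun n : ℕ => (n - a) / (a + b)) atTop atTop :=
    (Nat.tendsto_div_const_atTop hab.ne').comp (tendsto_sub_atTop_nat a)
  have hlim := (tendsto_pow_atTop_atTop_of_one_lt
    ((one_lt_div (pow_pos hL (a + b))).2 h)).comp htop
  filter_upwards [hlim.eventually_ge_atTop ((1 + L) ^ (a + (a + b))), eventually_ge_atTop a]
    with n hn hna
  set t := (n - a) / (a + b) with ht
  set r := (n - a) % (a + b)
  have hnt : n = t * (a + b) + (a + r) := by
    have : t * (a + b) + r = n - a := Nat.div_add_mod' (n - a) (a + b)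
    omega
  have hrlt : r < a + b := Nat.mod_lt _ hab
  have hcard := pow_mul_le_ncard_gridSet S (C₀ := C) (D₀ := D) (fun _ _ => subset_rfl)
    (fun _ _ => subset_rfl) a b r t
  rw [← hnt] at hcard
  have hpos : 1 ≤ (C a).ncard * (D r).ncard :=
    Nat.mul_pos ((Set.ncard_pos).2 (hC a)) ((Set.ncard_pos).2 (hD r))
  simp only [Function.comp_apply, ← ht, div_pow] at hn
  rw [le_div_iff₀ (by positivity)] at hn
  calc L ^ n = L ^ (a + r) * (L ^ (a + b)) ^ t := by
        rw [hnt, pow_add, mul_comm t, pow_mul, mul_comm]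
    _ ≤ (1 + L) ^ (a + (a + b)) * (L ^ (a + b)) ^ t := by
        gcongr
        exact (pow_le_pow_left₀ hL.le (by linarith) _).trans
          (pow_le_pow_right₀ (by linarith) (by omega))
    _ ≤ Q ^ t := hn
    _ ≤ _ := by
        rw [hQ]
        exact_mod_cast (Nat.le_mul_of_pos_right _ hpos).trans hcard

theorem lt_of_lt_sq_sqrt {L g : ℝ} (hL : 0 < L) (h : L < √g ^ 2) : L < g := by
  rcases le_or_gt g 0 with hg | hg
  · rw [Real.sqrt_eq_zero_of_nonpos hg] at h
    linarith
  · rwa [Real.sq_sqrt hg.le] at h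

/-- If `C` and `D` have finite proper growth rates `gC` and `gD`, then the
lower growth rate of any infinite `(C, D)` staircase is at least `(√gC + √gD)²`. -/
theorem staircase_lower_growth_ge (C D : PermClass) (gC gD : ℝ)
    (hC : HasGrowth C.mem gC) (hD : HasGrowth D.mem gD) (S : StaircaseData) :
    ENNReal.ofReal ((Real.sqrt gC + Real.sqrt gD) ^ 2) ≤ lgr (gridSet (S.M C.mem D.mem)) := by
  refine ofReal_le_lgr fun L hL hLg => ?_
  rcases le_or_gt gC 0 with hgC | hgC
  · rw [Real.sqrt_eq_zero_of_nonpos hgC, zero_add] at hLg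
    filter_upwards [eventually_pow_le_ncard hD hL (lt_of_lt_sq_sqrt hL hLg)] with n hn
    exact hn.trans (by exact_mod_cast ncard_right_le_ncard_gridSet S C.mem D.mem n)
  rcases le_or_gt gD 0 with hgD | hgD
  · rw [Real.sqrt_eq_zero_of_nonpos hgD, add_zero] at hLg
    filter_upwards [eventually_pow_le_ncard hC hL (lt_of_lt_sq_sqrt hL hLg)] with n hn
    exact hn.trans (by exact_mod_cast ncard_left_le_ncard_gridSet S C.mem D.mem n)
  have hCne := C.nonempty_of_hasGrowth hC hgC
  have hDne := D.nonempty_of_hasGrowth hD hgD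
  obtain ⟨a, b, hab, h⟩ := exists_pow_lt_ncard_mul hC hD hCne hDne hgC hgD hL hLg
  exact eventually_pow_le_ncard_gridSet S hCne hDne hab hL h
end

section
/- Let C and D be permutation classes each possessing a finite proper growth rate (gr(C) = lim_{n→∞} |C_n|^{1/n} and gr(D) = lim_{n→∞} |D_n|^{1/n} exist and are finite). Then for every t ≥ 1, the t-step restriction of any infinite (C,D) staircase possesses a proper growth rate equal to gr(C) + gr(D) + 2·√(gr(C)·gr(D))·cos(π/(t+1)). -/
open Filter Topology ENNReal

/-- A monotone function on `Fin n` takes values below `v` exactly on an initial segment. -/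
lemma monotone_lt_iff_lt_card {n : ℕ} {f : Fin n → ℕ} (hf : Monotone f) (v : ℕ) (i : Fin n) :
    f i < v ↔ (i : ℕ) < (Finset.univ.filter fun i' => f i' < v).card := by
  constructor
  · intro h
    have : Finset.Iic i ⊆ Finset.univ.filter fun i' => f i' < v := by
      intro a ha
      simp only [Finset.mem_Iic] at ha
      simp only [Finset.mem_filter, Finset.mem_univ, true_and]
      exact (hf ha).trans_lt h
    have := Finset.card_le_card this
    rw [Fin.card_Iic] at this
    omega
  · intro h
    by_contra hv
    have : (Finset.univ.filter fun i' => f i' < v) ⊆ Finset.Iio i := by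
      intro a ha
      simp only [Finset.mem_filter, Finset.mem_univ, true_and] at ha
      rw [Finset.mem_Iio]
      by_contra hia
      exact hv ((hf (not_lt.1 hia)).trans_lt ha)
    have := Finset.card_le_card this
    rw [Fin.card_Iio] at this
    omega

lemma prod_pow_self_of_card_le_one {κ : Type*} {s : Finset κ} (hs : s.card ≤ 1) (N : κ → ℕ) :
    ∏ j ∈ s, N j ^ N j = (∑ j ∈ s, N j) ^ (∑ j ∈ s, N j) := by
  rcases Nat.le_one_iff_eq_zero_or_eq_one.1 hs with h | h
  · rw [Finset.card_eq_zero] at h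
    simp [h]
  · obtain ⟨a, rfl⟩ := Finset.card_eq_one.1 h
    simp

lemma pow_self_le_choose (m k : ℕ) :
    (m + k) ^ (m + k) ≤ (m + k + 1) * ((m + k).choose m * (m ^ m * k ^ k)) := by
  have key : ∀ i ∈ Finset.range (m + k + 1),
      m ^ i * k ^ (m + k - i) * (m + k).choose i ≤ m ^ m * k ^ k * (m + k).choose m := by
    have step : ∀ i < m + k, (m ^ (i + 1) * k ^ (m + k - (i + 1)) * (m + k).choose (i + 1))
        * ((i + 1) * k) = (m ^ i * k ^ (m + k - i) * (m + k).choose i) * ((m + k - i) * m) := by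
      intro i hi
      have h1 := Nat.choose_succ_right_eq (m + k) i
      obtain ⟨d, hd⟩ : ∃ d, m + k - i = d + 1 := ⟨m + k - i - 1, by omega⟩
      have hd' : m + k - (i + 1) = d := by omega
      rw [hd] at h1 ⊢
      rw [hd']
      calc _ = m ^ (i + 1) * k ^ (d + 1) * ((m + k).choose (i + 1) * (i + 1)) := by ring
        _ = _ := by rw [h1]; ring
    rcases Nat.eq_zero_or_pos k with rfl | hk
    · intro i hi
      simp only [add_zero, Finset.mem_range] at hi ⊢
      rcases (Nat.lt_succ_iff.1 hi).eq_or_lt with rfl | h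
      · simp
      · rw [Nat.zero_pow (by omega)]; simp
    rcases Nat.eq_zero_or_pos m with rfl | hm
    · intro i hi
      rcases Nat.eq_zero_or_pos i with rfl | h
      · simp
      · rw [Nat.zero_pow (by omega)]; simp
    have up : ∀ d, d ≤ m → m ^ (m - d) * k ^ (m + k - (m - d)) * (m + k).choose (m - d)
        ≤ m ^ m * k ^ k * (m + k).choose m := by
      intro d
      induction d with
      | zero => intro _; simp
      | succ d ih =>
        intro hd
        refine le_trans ?_ (ih (by omega))
        have := step (m - (d + 1)) (by omega)
        rw [show m - (d + 1) + 1 = m - d by omega] at this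
        have h2 : (m - d) * k ≤ (m + k - (m - (d + 1))) * m := by
          rw [mul_comm]
          exact Nat.mul_le_mul (by omega) (by omega)
        refine Nat.le_of_mul_le_mul_right (c := (m - d) * k) ?_ (Nat.mul_pos (by omega) hk)
        rw [this]
        exact Nat.mul_le_mul_left _ h2
    have down : ∀ d, d ≤ k → m ^ (m + d) * k ^ (m + k - (m + d)) * (m + k).choose (m + d)
        ≤ m ^ m * k ^ k * (m + k).choose m := by
      intro d
      induction d with
      | zero => intro _; simp
      | succ d ih =>
        intro hd
        refine le_trans ?_ (ih (by omega))
        have := step (m + d) (by omega)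
        have h2 : (m + k - (m + d)) * m ≤ (m + d + 1) * k := by
          rw [mul_comm]
          exact Nat.mul_le_mul (by omega) (by omega)
        refine Nat.le_of_mul_le_mul_right (c := (m + d + 1) * k) ?_ (Nat.mul_pos (by omega) hk)
        rw [← add_assoc, this]
        exact Nat.mul_le_mul_left _ h2
    intro i hi
    rw [Finset.mem_range] at hi
    rcases le_total i m with h | h
    · have := up (m - i) (by omega)
      rwa [show m - (m - i) = i by omega] at this
    · have := down (i - m) (by omega)
      rwa [show m + (i - m) = i by omega] at this
  calc (m + k) ^ (m + k) = ∑ i ∈ Finset.range (m + k + 1),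
        m ^ i * k ^ (m + k - i) * (m + k).choose i := add_pow _ _ _
    _ ≤ (Finset.range (m + k + 1)).card • (m ^ m * k ^ k * (m + k).choose m) :=
        Finset.sum_le_card_nsmul _ _ _ key
    _ = _ := by rw [Finset.card_range, smul_eq_mul]; ring

section Words

variable {κ : Type*} [Fintype κ] [DecidableEq κ]

/-- Words of length `n` over the alphabet `κ` in which the letter `j` occurs `N j` times and
the keys of the letters weakly increase. -/
def sortedWords (n : ℕ) (key : κ → ℕ) (N : κ → ℕ) : Finset (Fin n → κ) :=
  open Classical in
  Finset.univ.filter fun W =>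
    Monotone (fun i => key (W i)) ∧ ∀ j, (Finset.univ.filter fun i => W i = j).card = N j

lemma mem_sortedWords {n : ℕ} {key : κ → ℕ} {N : κ → ℕ} {W : Fin n → κ} :
    W ∈ sortedWords n key N ↔ Monotone (fun i => key (W i)) ∧
      ∀ j, (Finset.univ.filter fun i => W i = j).card = N j := by
  simp [sortedWords]

lemma card_filter_comp {n : ℕ} {N : κ → ℕ} {W : Fin n → κ}
    (hW : ∀ j, (Finset.univ.filter fun i => W i = j).card = N j) (p : κ → Prop)
    [DecidablePred p] :
    (Finset.univ.filter fun i => p (W i)).card = ∑ j with p j, N j := by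
  rw [Finset.card_eq_sum_card_fiberwise (f := W) (t := Finset.univ.filter p)]
  · refine Finset.sum_congr rfl fun j hj => ?_
    rw [← hW j, Finset.filter_filter]
    congr 1
    ext i
    simp only [Finset.mem_filter, Finset.mem_univ, true_and] at hj ⊢
    constructor
    · exact fun h => h.2
    · intro h; exact ⟨h ▸ hj, h⟩
  · intro i hi
    simpa using hi

lemma key_eq_of_mem_sortedWords {n : ℕ} {key : κ → ℕ} {N : κ → ℕ} {W W' : Fin n → κ}
    (hW : W ∈ sortedWords n key N) (hW' : W' ∈ sortedWords n key N) (i : Fin n) :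
    key (W i) = key (W' i) := by
  rw [mem_sortedWords] at hW hW'
  have h : ∀ v, key (W i) < v ↔ key (W' i) < v := by
    intro v
    have h1 := monotone_lt_iff_lt_card hW.1 v i
    have h2 := monotone_lt_iff_lt_card hW'.1 v i
    rw [card_filter_comp hW.2 (fun j => key j < v)] at h1
    rw [card_filter_comp hW'.2 (fun j => key j < v)] at h2
    exact h1.trans h2.symm
  have h1 := h (key (W i) + 1)
  have h2 := h (key (W' i) + 1)
  omega

lemma prod_comp_of_mem_sortedWords {n : ℕ} {key : κ → ℕ} {N : κ → ℕ} {W : Fin n → κ}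
    (hW : W ∈ sortedWords n key N) (q : κ → ℝ) : ∏ i, q (W i) = ∏ j, q j ^ N j := by
  rw [mem_sortedWords] at hW
  rw [← Finset.prod_fiberwise (s := Finset.univ) (g := W)]
  refine Finset.prod_congr rfl fun j _ => ?_
  rw [← hW.2 j, Finset.prod_congr rfl (g := fun _ => q j), Finset.prod_const]
  intro i hi
  simp only [Finset.mem_filter, Finset.mem_univ, true_and] at hi
  rw [hi]

lemma card_sortedWords_mul_le {n : ℕ} {key : κ → ℕ} {N : κ → ℕ} {q : κ → ℝ}
    (hq : ∀ j, 0 ≤ q j) (hs : ∀ v, ∑ j with key j = v, q j ≤ 1) :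
    ((sortedWords n key N).card : ℝ) * ∏ j, q j ^ N j ≤ 1 := by
  rcases (sortedWords n key N).eq_empty_or_nonempty with h | ⟨W₀, hW₀⟩
  · simp [h]
  · calc ((sortedWords n key N).card : ℝ) * ∏ j, q j ^ N j
        = ∑ W ∈ sortedWords n key N, ∏ i, q (W i) := by
          rw [Finset.sum_congr rfl fun W hW => prod_comp_of_mem_sortedWords hW q]
          simp
      _ ≤ ∑ W ∈ Fintype.piFinset fun i => Finset.univ.filter fun j => key j = key (W₀ i),
            ∏ i, q (W i) := by
          refine Finset.sum_le_sum_of_subset_of_nonneg ?_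
            fun W _ _ => Finset.prod_nonneg fun i _ => hq _
          intro W hW
          simp only [Fintype.mem_piFinset, Finset.mem_filter, Finset.mem_univ, true_and]
          exact key_eq_of_mem_sortedWords hW hW₀
      _ = ∏ i, ∑ j with key j = key (W₀ i), q j := by
          rw [Finset.prod_univ_sum]
      _ ≤ 1 := Finset.prod_le_one (fun i _ => Finset.sum_nonneg fun j _ => hq j)
          fun i _ => hs _

lemma sortedWords_nonempty {n : ℕ} (key : κ → ℕ) {N : κ → ℕ} (hN : ∑ j, N j = n) :
    (sortedWords n key N).Nonempty := by
  have e : (Σ j, Fin (N j)) ≃ Fin n := Fintype.equivFinOfCardEq (by simp [hN])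
  let W₀ : Fin n → κ := fun i => (e.symm i).1
  let s := Tuple.sort (fun i => key (W₀ i))
  refine ⟨fun i => W₀ (s i), mem_sortedWords.2 ⟨Tuple.monotone_sort (fun i => key (W₀ i)), ?_⟩⟩
  intro j
  have : (Finset.univ.filter fun i => W₀ (s i) = j)
      = (Finset.univ : Finset (Fin (N j))).map
        ⟨fun a => s.symm (e ⟨j, a⟩), fun a b h => by simpa using h⟩ := by
    ext i
    simp only [Finset.mem_filter, Finset.mem_univ, true_and, Finset.mem_map]
    constructor
    · intro h
      refine ⟨h ▸ (e.symm (s i)).2, ?_⟩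
      subst h
      change s.symm (e (e.symm (s i))) = i
      simp
    · rintro ⟨a, rfl⟩
      change (e.symm (s (s.symm (e ⟨j, a⟩)))).1 = j
      simp
  rw [this]
  simp

/-- If the letters sharing a key can be told apart by a predicate `P` (so that there are at most
two of them), the sorted words include all those obtained by choosing, for every key, the
positions of the letter satisfying `P`. -/
lemma prod_choose_le_card_sortedWords {n : ℕ} {key : κ → ℕ} {N : κ → ℕ} (hN : ∑ j, N j = n)
    (P : κ → Prop) [DecidablePred P]
    (hP : ∀ j j', key j = key j' → (P j ↔ P j') → j = j') :
    ∏ q ∈ Finset.univ.image key,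
      (∑ j with key j = q, N j).choose (∑ j with key j = q ∧ P j, N j)
      ≤ (sortedWords n key N).card := by
  obtain ⟨W₀, hW₀⟩ := sortedWords_nonempty key hN
  have hW₀' := mem_sortedWords.1 hW₀
  have : Nonempty (Fin n → κ) := ⟨W₀⟩
  let B : Finset.univ.image key → Finset (Fin n) := fun q => Finset.univ.filter fun i => key (W₀ i) = q.1
  have hB : ∀ q, (B q).card = ∑ j with key j = q.1, N j := fun q =>
    card_filter_comp hW₀'.2 fun j => key j = q.1
  let L : Finset.univ.image key → ℕ := fun q => ∑ j with key j = q.1 ∧ P j, N j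
  let k : κ → Finset.univ.image key := fun j => ⟨key j, Finset.mem_image_of_mem _ (Finset.mem_univ _)⟩
  let T : Finset (Finset.univ.image key → Finset (Fin n)) :=
    Fintype.piFinset fun q => Finset.powersetCard (L q) (B q)
  have hT : T.card = ∏ q ∈ Finset.univ.image key,
      (∑ j with key j = q, N j).choose (∑ j with key j = q ∧ P j, N j) := by
    rw [Fintype.card_piFinset, ← Finset.prod_coe_sort (M := ℕ) (Finset.univ.image key)]
    refine Finset.prod_congr rfl fun q _ => ?_
    rw [Finset.card_powersetCard, hB]
  have hLP : ∀ j, P j → L (k j) = N j := by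
    intro j hj
    have : (Finset.univ.filter fun j' => key j' = (k j).1 ∧ P j') = {j} := by
      ext j'
      simp only [Finset.mem_filter, Finset.mem_univ, true_and, Finset.mem_singleton]
      constructor
      · rintro ⟨h1, h2⟩
        exact hP _ _ h1 (by tauto)
      · rintro rfl
        exact ⟨rfl, hj⟩
    simp only [L, this, Finset.sum_singleton]
  have hsplit : ∀ q : Finset.univ.image key, (∑ j with key j = q.1, N j)
      = L q + ∑ j with key j = q.1 ∧ ¬ P j, N j := by
    intro q
    rw [← Finset.sum_filter_add_sum_filter_not (Finset.univ.filter fun j => key j = q.1) P,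
      Finset.filter_filter, Finset.filter_filter]
  have hLN : ∀ j, ¬ P j → (∑ j' with key j' = (k j).1, N j') - L (k j) = N j := by
    intro j hj
    have : (Finset.univ.filter fun j' => key j' = (k j).1 ∧ ¬ P j') = {j} := by
      ext j'
      simp only [Finset.mem_filter, Finset.mem_univ, true_and, Finset.mem_singleton]
      constructor
      · rintro ⟨h1, h2⟩
        exact hP _ _ h1 (by tauto)
      · rintro rfl
        exact ⟨rfl, hj⟩
    rw [hsplit, this, Finset.sum_singleton, Nat.add_sub_cancel_left]
  have hex : ∀ A ∈ T, ∃ W ∈ sortedWords n key N,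
      ∀ i, key (W i) = key (W₀ i) ∧ (P (W i) ↔ i ∈ A (k (W₀ i))) := by
    intro A hA
    simp only [T, Fintype.mem_piFinset, Finset.mem_powersetCard] at hA
    have hletter : ∀ i, ∃ j, key j = key (W₀ i) ∧ (P j ↔ i ∈ A (k (W₀ i))) := by
      intro i
      have hiB : i ∈ B (k (W₀ i)) := by simp [B, k]
      by_cases hi : i ∈ A (k (W₀ i))
      · have h1 : L (k (W₀ i)) ≠ 0 := by
          rw [← (hA (k (W₀ i))).2]
          exact Finset.card_ne_zero_of_mem hi
        obtain ⟨j, hj, -⟩ := Finset.exists_ne_zero_of_sum_ne_zero h1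
        simp only [Finset.mem_filter, Finset.mem_univ, true_and] at hj
        exact ⟨j, hj.1, by tauto⟩
      · have h1 : (A (k (W₀ i))).card < (B (k (W₀ i))).card :=
          Finset.card_lt_card ((Finset.ssubset_iff_of_subset (hA _).1).2 ⟨i, hiB, hi⟩)
        rw [(hA _).2, hB, hsplit] at h1
        have h2 : (∑ j with key j = (k (W₀ i)).1 ∧ ¬ P j, N j) ≠ 0 := by omega
        obtain ⟨j, hj, -⟩ := Finset.exists_ne_zero_of_sum_ne_zero h2
        simp only [Finset.mem_filter, Finset.mem_univ, true_and] at hj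
        exact ⟨j, hj.1, by tauto⟩
    choose W hW using hletter
    refine ⟨W, mem_sortedWords.2 ⟨?_, ?_⟩, hW⟩
    · simpa only [(hW _).1] using hW₀'.1
    · intro j
      by_cases hj : P j
      · have : (Finset.univ.filter fun i => W i = j) = A (k j) := by
          ext i
          simp only [Finset.mem_filter, Finset.mem_univ, true_and]
          constructor
          · rintro rfl
            have := (hW i).2.1 hj
            rwa [show k (W i) = k (W₀ i) from Subtype.ext (hW i).1]
          · intro hi
            have h1 : key (W₀ i) = key j := by simpa [B, k] using (hA (k j)).1 hi
            have h2 : k (W₀ i) = k j := Subtype.ext h1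
            refine hP _ _ ((hW i).1.trans h1) ?_
            rw [(hW i).2, h2]
            tauto
        rw [this, (hA _).2, hLP j hj]
      · have : (Finset.univ.filter fun i => W i = j) = B (k j) \ A (k j) := by
          ext i
          simp only [Finset.mem_filter, Finset.mem_univ, true_and, Finset.mem_sdiff]
          constructor
          · rintro rfl
            rw [show k (W i) = k (W₀ i) from Subtype.ext (hW i).1]
            exact ⟨by simp [B, k], fun h => hj ((hW i).2.2 h)⟩
          · rintro ⟨hi, hi'⟩
            have h1 : key (W₀ i) = key j := by simpa [B, k] using hi
            have h2 : k (W₀ i) = k j := Subtype.ext h1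
            refine hP _ _ ((hW i).1.trans h1) ?_
            rw [(hW i).2, h2]
            tauto
        rw [this, Finset.card_sdiff_of_subset (hA _).1, (hA _).2, hB, hLN j hj]
  choose! W hW using hex
  rw [← hT]
  refine Finset.card_le_card_of_injOn W (fun A hA => (hW A hA).1) ?_
  intro A hA A' hA' h
  have main : ∀ A ∈ T, ∀ q i, i ∈ A q ↔ key (W₀ i) = q.1 ∧ P (W A i) := by
    intro A hA q i
    have hA2 := hA
    simp only [T, Fintype.mem_piFinset, Finset.mem_powersetCard] at hA2
    constructor
    · intro hi
      have h1 : key (W₀ i) = q.1 := by simpa [B] using (hA2 q).1 hi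
      refine ⟨h1, ((hW A hA).2 i).2.2 ?_⟩
      rwa [show k (W₀ i) = q from Subtype.ext h1]
    · rintro ⟨h1, h2⟩
      have := ((hW A hA).2 i).2.1 h2
      rwa [show k (W₀ i) = q from Subtype.ext h1] at this
  funext q
  ext i
  rw [main A hA, main A' hA', h]

lemma prod_pow_le_card_sortedWords_mul {n : ℕ} {key : κ → ℕ} {N : κ → ℕ} (hN : ∑ j, N j = n)
    (P : κ → Prop) [DecidablePred P]
    (hP : ∀ j j', key j = key j' → (P j ↔ P j') → j = j') :
    ∏ j, (∑ j' with key j' = key j, N j') ^ N j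
      ≤ (n + 1) ^ Fintype.card κ * ((sortedWords n key N).card * ∏ j, N j ^ N j) := by
  have hmaps : ∀ j ∈ (Finset.univ : Finset κ), key j ∈ Finset.univ.image key :=
    fun j _ => Finset.mem_image_of_mem _ (Finset.mem_univ _)
  have hone : ∀ q, ((Finset.univ.filter fun j => key j = q ∧ P j).card ≤ 1) ∧
      ((Finset.univ.filter fun j => key j = q ∧ ¬ P j).card ≤ 1) := by
    intro q
    simp only [Finset.card_le_one, Finset.mem_filter, Finset.mem_univ, true_and]
    exact ⟨fun a ha b hb => hP a b (ha.1.trans hb.1.symm) (by tauto),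
      fun a ha b hb => hP a b (ha.1.trans hb.1.symm) (by tauto)⟩
  have hS : ∀ q, ∑ j with key j = q, N j ≤ n := by
    intro q
    rw [← hN]
    exact Finset.sum_le_sum_of_subset (Finset.filter_subset _ _)
  calc ∏ j, (∑ j' with key j' = key j, N j') ^ N j
      = ∏ q ∈ Finset.univ.image key,
          (∑ j' with key j' = q, N j') ^ (∑ j' with key j' = q, N j') := by
        rw [← Finset.prod_fiberwise_of_maps_to hmaps]
        refine Finset.prod_congr rfl fun q _ => ?_
        rw [← Finset.prod_pow_eq_pow_sum]
        refine Finset.prod_congr rfl fun j hj => ?_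
        rw [(Finset.mem_filter.1 hj).2]
    _ ≤ ∏ q ∈ Finset.univ.image key, (n + 1) *
          ((∑ j with key j = q, N j).choose (∑ j with key j = q ∧ P j, N j) *
            ∏ j with key j = q, N j ^ N j) := by
        refine Finset.prod_le_prod' fun q _ => ?_
        have h1 := Finset.sum_filter_add_sum_filter_not
          (Finset.univ.filter fun j => key j = q) P N
        have h2 := Finset.prod_filter_mul_prod_filter_not
          (Finset.univ.filter fun j => key j = q) P fun j => N j ^ N j
        rw [Finset.filter_filter, Finset.filter_filter] at h1 h2
        rw [prod_pow_self_of_card_le_one (hone q).1,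
          prod_pow_self_of_card_le_one (hone q).2] at h2
        rw [← h2, ← h1]
        refine (pow_self_le_choose _ _).trans (Nat.mul_le_mul_right _ ?_)
        have := hS q
        omega
    _ = (n + 1) ^ (Finset.univ.image key).card *
          ((∏ q ∈ Finset.univ.image key,
            (∑ j with key j = q, N j).choose (∑ j with key j = q ∧ P j, N j)) *
              ∏ j, N j ^ N j) := by
        rw [Finset.prod_mul_distrib, Finset.prod_mul_distrib, Finset.prod_const,
          Finset.prod_fiberwise_of_maps_to hmaps]
    _ ≤ _ := by
        refine Nat.mul_le_mul ?_ (Nat.mul_le_mul_right _ (prod_choose_le_card_sortedWords hN P hP))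
        exact Nat.pow_le_pow_right (Nat.succ_pos _) Finset.card_image_le

end Words

section Gridding

/-- The family `F` together with the empty permutation. -/
def withEmpty (F : ∀ m, Set (Perm m)) : ∀ m, Set (Perm m) := fun m => {σ | m = 0 ∨ σ ∈ F m}

lemma subpermIn_withEmpty_iff {n : ℕ} {π : Perm n} {A : Set (Fin n)} {F : ∀ m, Set (Perm m)} :
    SubpermIn π A (withEmpty F) ↔ A = ∅ ∨ SubpermIn π A F := by
  constructor
  · rintro ⟨m, σ, f, hf, hσ, h | h⟩
    · subst h
      left
      rw [← hf]
      exact Set.range_eq_empty _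
    · exact Or.inr ⟨m, σ, f, hf, hσ, h⟩
  · rintro (rfl | ⟨m, σ, f, hf, hσ, h⟩)
    · exact ⟨0, 1, ⟨⟨Fin.elim0, fun a => a.elim0⟩, fun {a} => a.elim0⟩,
        Set.range_eq_empty _, fun i => i.elim0, Or.inl rfl⟩
    · exact ⟨m, σ, f, hf, hσ, Or.inr h⟩

lemma exists_interval_of_monotone {c : ℕ → ℕ} (h0 : c 0 = 0) {x n : ℕ} (hx : x < n)
    (hn : ∃ k, c k = n) : ∃ k, c k ≤ x ∧ x < c (k + 1) := by
  obtain ⟨K, hK⟩ := hn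
  have hex : ∃ k, x < c k := ⟨K, by omega⟩
  have h1 := Nat.find_spec hex
  have h2 : Nat.find hex ≠ 0 := by
    intro h
    rw [h] at h1
    omega
  obtain ⟨k, hk⟩ := Nat.exists_eq_succ_of_ne_zero h2
  refine ⟨k, ?_, ?_⟩
  · have := Nat.find_min hex (m := k) (by omega)
    omega
  · rwa [hk] at h1

lemma interval_le_of_le {c : ℕ → ℕ} (hc : Monotone c) {x y k l : ℕ} (hxy : x ≤ y)
    (hk : c k ≤ x) (hl : y < c (l + 1)) : k ≤ l := by
  by_contra h
  have : c (l + 1) ≤ c k := hc (by omega)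
  omega

variable {κ : Type*} {M : ℕ → ℕ → ∀ m, Set (Perm m)} {pos : κ → ℕ × ℕ}
  {F : κ → ∀ m, Set (Perm m)}

lemma exists_labelling_of_mem_gridSet
    (hM : ∀ j, M (pos j).1 (pos j).2 = F j)
    (hM' : ∀ k l, (∀ j, pos j ≠ (k, l)) → M k l = emptyCell) {n : ℕ} {π : Perm n}
    (hπ : π ∈ gridSet M n) :
    ∃ W : Fin n → κ, Monotone (fun i => (pos (W i)).1) ∧
      Monotone (fun v => (pos (W (π.symm v))).2) ∧
      ∀ j, SubpermIn π {i | pos (W i) = pos j} (withEmpty (F j)) := by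
  obtain ⟨c, r, hc, hr, hc0, hr0, -, -, hcn, hrn, hcell⟩ := hπ
  have hlab : ∀ i : Fin n, ∃ j, i ∈ cellSet π c r (pos j).1 (pos j).2 := by
    intro i
    obtain ⟨k, hk1, hk2⟩ := exists_interval_of_monotone hc0 i.2 hcn
    obtain ⟨l, hl1, hl2⟩ := exists_interval_of_monotone hr0 (π i).2 hrn
    have hi : i ∈ cellSet π c r k l := ⟨hk1, hk2, hl1, hl2⟩
    by_contra! hne
    have hE := hM' k l fun j hj => hne j (by rw [hj]; exact hi)
    rcases hcell k l with h | ⟨m, σ, f, hf, -, hm⟩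
    · rw [h] at hi
      exact hi
    · rw [hE] at hm
      have hm0 : m = 0 := hm
      subst hm0
      rw [← hf] at hi
      obtain ⟨a, -⟩ := hi
      exact a.elim0
  choose W hW using hlab
  refine ⟨W, ?_, ?_, ?_⟩
  · intro i i' hii'
    exact interval_le_of_le hc (Fin.le_def.1 hii') (hW i).1 (hW i').2.1
  · intro v v' hvv'
    have h1 := (hW (π.symm v)).2.2.1
    have h2 := (hW (π.symm v')).2.2.2
    rw [Equiv.apply_symm_apply] at h1 h2
    exact interval_le_of_le hr (Fin.le_def.1 hvv') h1 h2
  · intro j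
    rw [subpermIn_withEmpty_iff]
    have : {i | pos (W i) = pos j} = cellSet π c r (pos j).1 (pos j).2 := by
      ext i
      constructor
      · intro h
        have := hW i
        rwa [show pos (W i) = pos j from h] at this
      · rintro ⟨h1, h2, h3, h4⟩
        obtain ⟨h5, h6, h7, h8⟩ := hW i
        refine Prod.ext ?_ ?_
        · exact le_antisymm (interval_le_of_le hc le_rfl h5 h2)
            (interval_le_of_le hc le_rfl h1 h6)
        · exact le_antisymm (interval_le_of_le hr le_rfl h7 h4)
            (interval_le_of_le hr le_rfl h3 h8)
    rw [this, ← hM j]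
    exact hcell _ _

lemma exists_dividers {n : ℕ} {f : Fin n → ℕ} (hf : Monotone f) :
    ∃ c : ℕ → ℕ, Monotone c ∧ c 0 = 0 ∧ (∀ k, c k ≤ n) ∧ (∃ k, c k = n) ∧
      ∀ k (i : Fin n), (c k ≤ (i : ℕ) ∧ (i : ℕ) < c (k + 1)) ↔ f i = k := by
  refine ⟨fun v => (Finset.univ.filter fun i => f i < v).card, ?_, by simp, ?_, ?_, ?_⟩
  · intro a b hab
    refine Finset.card_le_card fun i => ?_
    simp only [Finset.mem_filter, Finset.mem_univ, true_and]
    exact fun h => h.trans_le hab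
  · intro k
    exact (Finset.card_le_univ _).trans (Fintype.card_fin n).le
  · refine ⟨Finset.univ.sup f + 1, ?_⟩
    change (Finset.univ.filter fun i => f i < Finset.univ.sup f + 1).card = n
    rw [Finset.filter_true_of_mem, Finset.card_univ, Fintype.card_fin]
    intro i _
    exact Nat.lt_succ_of_le (Finset.le_sup (f := f) (Finset.mem_univ i))
  · intro k i
    rw [← monotone_lt_iff_lt_card hf, ← not_lt, ← monotone_lt_iff_lt_card hf]
    omega

lemma mem_gridSet_of_labelling
    (hM : ∀ j, M (pos j).1 (pos j).2 = F j) {n : ℕ} {π : Perm n} (W : Fin n → κ)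
    (hcol : Monotone fun i => (pos (W i)).1)
    (hrow : Monotone fun v => (pos (W (π.symm v))).2)
    (hF : ∀ j, SubpermIn π {i | pos (W i) = pos j} (withEmpty (F j))) :
    π ∈ gridSet M n := by
  obtain ⟨c, hc, hc0, hcn, hcn', hck⟩ := exists_dividers hcol
  obtain ⟨r, hr, hr0, hrn, hrn', hrk⟩ := exists_dividers hrow
  refine ⟨c, r, hc, hr, hc0, hr0, hcn, hrn, hcn', hrn', fun k l => ?_⟩
  have hcell : cellSet π c r k l = {i | pos (W i) = (k, l)} := by
    ext i
    have h1 := hck k i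
    have h2 := hrk l (π i)
    rw [Equiv.symm_apply_apply] at h2
    simp only [cellSet, Set.mem_ofPred_eq, Prod.ext_iff, ← h1, ← h2, and_assoc]
  rw [hcell]
  by_cases h : ∃ i, pos (W i) = (k, l)
  · obtain ⟨i, hi⟩ := h
    have h1 := (subpermIn_withEmpty_iff (F := F (W i))).1 (hF (W i))
    rw [← hM, hi] at h1
    exact h1
  · left
    ext i
    simpa using fun hi => h ⟨i, hi⟩

end Gridding

section Counting

lemma perm_eq_of_lt_iff_lt {m : ℕ} {σ τ : Perm m} (h : ∀ a b, σ a < σ b ↔ τ a < τ b) :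
    σ = τ := by
  let e : Fin m ≃o Fin m := StrictMono.orderIsoOfSurjective (fun x => τ (σ.symm x))
    (fun x y hxy => by
      rw [← h]
      simpa using hxy) (τ.surjective.comp σ.symm.surjective)
  have h1 : e = OrderIso.refl _ := Subsingleton.elim _ _
  ext a
  have h2 : e (σ a) = σ a := by rw [h1]; rfl
  have h3 : e (σ a) = τ a := by
    change τ (σ.symm (σ a)) = τ a
    rw [Equiv.symm_apply_apply]
  rw [← h2, h3]

variable {κ : Type*} [DecidableEq κ]

/-- The increasing enumeration of the positions of the letter `j` in a word `W` with letter
counts `N`. -/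
def letterEnum {n : ℕ} {W : Fin n → κ} {N : κ → ℕ}
    (hW : ∀ j, (Finset.univ.filter fun i => W i = j).card = N j) (j : κ) : Fin (N j) ↪o Fin n :=
  (Finset.univ.filter fun i => W i = j).orderEmbOfFin (hW j)

lemma letterEnum_apply {n : ℕ} {W : Fin n → κ} {N : κ → ℕ}
    (hW : ∀ j, (Finset.univ.filter fun i => W i = j).card = N j) (j : κ) (a : Fin (N j)) :
    W (letterEnum hW j a) = j := by
  have := Finset.orderEmbOfFin_mem (Finset.univ.filter fun i => W i = j) (hW j) a
  exact (Finset.mem_filter.1 this).2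

lemma letterEnum_unique {n : ℕ} {W : Fin n → κ} {N : κ → ℕ}
    (hW : ∀ j, (Finset.univ.filter fun i => W i = j).card = N j) {j : κ} {f : Fin (N j) → Fin n}
    (hf : ∀ a, W (f a) = j) (hmono : StrictMono f) : f = letterEnum hW j :=
  Finset.orderEmbOfFin_unique (hW j) (fun a => by simpa using hf a) hmono

lemma range_letterEnum {n : ℕ} {W : Fin n → κ} {N : κ → ℕ}
    (hW : ∀ j, (Finset.univ.filter fun i => W i = j).card = N j) (j : κ) :
    Set.range (letterEnum hW j) = {i | W i = j} := by
  rw [letterEnum, Finset.range_orderEmbOfFin]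
  ext i
  simp

lemma exists_letterEnum_eq {n : ℕ} {W : Fin n → κ} {N : κ → ℕ}
    (hW : ∀ j, (Finset.univ.filter fun i => W i = j).card = N j) (i : Fin n) :
    ∃ a, letterEnum hW (W i) a = i := by
  have : i ∈ Set.range (letterEnum hW (W i)) := by
    rw [range_letterEnum]
    rfl
  exact this

lemma exists_pattern_of_subpermIn {n : ℕ} {W : Fin n → κ} {N : κ → ℕ}
    (hW : ∀ j, (Finset.univ.filter fun i => W i = j).card = N j) {π : Perm n} {j : κ}
    {F : ∀ m, Set (Perm m)} (h : SubpermIn π {i | W i = j} F) :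
    ∃ σ ∈ F (N j), ∀ a b, σ a < σ b ↔ π (letterEnum hW j a) < π (letterEnum hW j b) := by
  obtain ⟨m, σ, f, hf, hσ, hm⟩ := h
  have hmN : m = N j := by
    have h1 : (Finset.univ.map f.toEmbedding) = Finset.univ.filter fun i => W i = j := by
      ext i
      have : i ∈ Set.range f ↔ W i = j := by rw [hf]; rfl
      simpa using this
    rw [← hW j, ← h1, Finset.card_map, Finset.card_univ, Fintype.card_fin]
  subst hmN
  refine ⟨σ, hm, ?_⟩
  rw [← letterEnum_unique hW (f := f) (fun a => ?_) f.strictMono]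
  · exact hσ
  · have : f a ∈ Set.range f := ⟨a, rfl⟩
    rw [hf] at this
    exact this

lemma apply_letterEnum {n : ℕ} {W V : Fin n → κ} {N : κ → ℕ}
    (hW : ∀ j, (Finset.univ.filter fun i => W i = j).card = N j)
    (hV : ∀ j, (Finset.univ.filter fun i => V i = j).card = N j) {π : Perm n}
    (hπ : ∀ i, V (π i) = W i) {j : κ} {σ : Perm (N j)}
    (hσ : ∀ a b, σ a < σ b ↔ π (letterEnum hW j a) < π (letterEnum hW j b)) (a : Fin (N j)) :
    π (letterEnum hW j a) = letterEnum hV j (σ a) := by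
  have := letterEnum_unique hV (j := j) (f := fun b => π (letterEnum hW j (σ.symm b)))
    (fun b => by rw [hπ, letterEnum_apply hW])
    (fun b b' hb => by
      rw [← hσ]
      simpa using hb)
  have := congrFun this (σ a)
  simpa using this

lemma exists_perm_of_patterns {n : ℕ} {W V : Fin n → κ} {N : κ → ℕ}
    (hW : ∀ j, (Finset.univ.filter fun i => W i = j).card = N j)
    (hV : ∀ j, (Finset.univ.filter fun i => V i = j).card = N j) (σ : ∀ j, Perm (N j)) :
    ∃ π : Perm n, (∀ i, V (π i) = W i) ∧
      ∀ j a b, σ j a < σ j b ↔ π (letterEnum hW j a) < π (letterEnum hW j b) := by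
  have hbij : ∀ {W : Fin n → κ} (hW : ∀ j, (Finset.univ.filter fun i => W i = j).card = N j),
      Function.Bijective fun x : Σ j, Fin (N j) => letterEnum hW x.1 x.2 := by
    intro W hW
    constructor
    · rintro ⟨j, a⟩ ⟨j', a'⟩ h
      have h1 : j = j' := by
        rw [← letterEnum_apply hW j a, ← letterEnum_apply hW j' a']
        exact congrArg W h
      subst h1
      exact congrArg (Sigma.mk j) ((letterEnum hW j).injective h)
    · intro i
      obtain ⟨a, ha⟩ := exists_letterEnum_eq hW i
      exact ⟨⟨W i, a⟩, ha⟩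
  let eW := Equiv.ofBijective _ (hbij hW)
  let eV := Equiv.ofBijective _ (hbij hV)
  let π : Perm n := (eW.symm.trans (Equiv.sigmaCongrRight σ)).trans eV
  have key : ∀ j a, π (letterEnum hW j a) = letterEnum hV j (σ j a) := by
    intro j a
    have h1 : eW.symm (letterEnum hW j a) = ⟨j, a⟩ := by
      rw [Equiv.symm_apply_eq]
      rfl
    change eV (Equiv.sigmaCongrRight σ (eW.symm (letterEnum hW j a))) = _
    rw [h1]
    rfl
  refine ⟨π, ?_, ?_⟩
  · intro i
    obtain ⟨a, ha⟩ := exists_letterEnum_eq hW i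
    rw [← ha, key, letterEnum_apply hV, letterEnum_apply hW]
  · intro j a b
    rw [key, key, OrderEmbedding.lt_iff_lt]

variable [Fintype κ]

/-- The choices of one permutation of length `N j` from the `j`-th family, for every `j`. -/
noncomputable def patternChoices (F : κ → ∀ m, Set (Perm m)) (N : κ → ℕ) :
    Finset (∀ j, Perm (N j)) :=
  Fintype.piFinset fun j => (Set.toFinite (F j (N j))).toFinset

lemma mem_patternChoices {F : κ → ∀ m, Set (Perm m)} {N : κ → ℕ} {σ : ∀ j, Perm (N j)} :
    σ ∈ patternChoices F N ↔ ∀ j, σ j ∈ F j (N j) := by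
  simp [patternChoices]

lemma card_patternChoices (F : κ → ∀ m, Set (Perm m)) (N : κ → ℕ) :
    (patternChoices F N).card = ∏ j, (F j (N j)).ncard := by
  rw [patternChoices, Fintype.card_piFinset]
  exact Finset.prod_congr rfl fun j _ => (Set.ncard_eq_toFinset_card _ _).symm

lemma ncard_perms_with_words_le {n : ℕ} {W V : Fin n → κ} {N : κ → ℕ}
    (hW : ∀ j, (Finset.univ.filter fun i => W i = j).card = N j)
    (hV : ∀ j, (Finset.univ.filter fun i => V i = j).card = N j)
    (F : κ → ∀ m, Set (Perm m)) :
    {π : Perm n | (∀ i, V (π i) = W i) ∧ ∀ j, SubpermIn π {i | W i = j} (F j)}.ncard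
      ≤ ∏ j, (F j (N j)).ncard := by
  have hex : ∀ π ∈ {π : Perm n | (∀ i, V (π i) = W i) ∧ ∀ j, SubpermIn π {i | W i = j} (F j)},
      ∃ σ ∈ patternChoices F N, ∀ j a b, σ j a < σ j b ↔
        π (letterEnum hW j a) < π (letterEnum hW j b) := by
    rintro π ⟨-, h⟩
    choose σ hσ hσ' using fun j => exists_pattern_of_subpermIn hW (h j)
    exact ⟨σ, mem_patternChoices.2 hσ, hσ'⟩
  choose! g hg hg' using hex
  rw [← card_patternChoices, ← Set.ncard_coe_finset]
  refine Set.ncard_le_ncard_of_injOn g (fun π hπ => hg π hπ) ?_ (Set.toFinite _)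
  intro π hπ π' hπ' h
  ext i
  obtain ⟨a, ha⟩ := exists_letterEnum_eq hW i
  rw [← ha, apply_letterEnum hW hV hπ.1 (hg' π hπ (W i)),
    apply_letterEnum hW hV hπ'.1 (hg' π' hπ' (W i)), h]

variable {M : ℕ → ℕ → ∀ m, Set (Perm m)} {pos : κ → ℕ × ℕ} {F : κ → ∀ m, Set (Perm m)}

lemma ncard_gridSet_le (hpos : Function.Injective pos)
    (hM : ∀ j, M (pos j).1 (pos j).2 = F j)
    (hM' : ∀ k l, (∀ j, pos j ≠ (k, l)) → M k l = emptyCell) (n : ℕ) :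
    (gridSet M n).ncard ≤ ∑ N ∈ Fintype.piFinset (fun _ : κ => Finset.range (n + 1)) with
        ∑ j, N j = n,
      (sortedWords n (fun j => (pos j).1) N).card * (sortedWords n (fun j => (pos j).2) N).card *
        ∏ j, (withEmpty (F j) (N j)).ncard := by
  let T := Finset.filter (fun N : κ → ℕ => ∑ j, N j = n)
    (Fintype.piFinset (fun _ : κ => Finset.range (n + 1)))
  let Z : (κ → ℕ) → Finset ((Fin n → κ) × (Fin n → κ)) := fun N =>
    sortedWords n (fun j => (pos j).1) N ×ˢ sortedWords n (fun j => (pos j).2) N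
  let G : (Fin n → κ) × (Fin n → κ) → Set (Perm n) := fun p =>
    {π : Perm n | (∀ i, p.2 (π i) = p.1 i) ∧
      ∀ j, SubpermIn π {i | p.1 i = j} (withEmpty (F j))}
  have hsub : gridSet M n ⊆ ⋃ N ∈ T, ⋃ p ∈ Z N, G p := by
    intro π hπ
    obtain ⟨W, hcol, hrow, hF⟩ := exists_labelling_of_mem_gridSet hM hM' hπ
    simp only [hpos.eq_iff] at hF
    let N : κ → ℕ := fun j => (Finset.univ.filter fun i => W i = j).card
    have hN : ∑ j, N j = n := by
      have := Finset.card_eq_sum_card_fiberwise (f := W) (s := Finset.univ) (t := Finset.univ)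
        (fun _ _ => Finset.mem_coe.2 (Finset.mem_univ _))
      rw [Finset.card_univ, Fintype.card_fin] at this
      exact this.symm
    simp only [Set.mem_iUnion, exists_prop]
    refine ⟨N, ?_, (W, fun v => W (π.symm v)), ?_, ?_, hF⟩
    · simp only [T, Finset.mem_filter, Fintype.mem_piFinset, Finset.mem_range]
      refine ⟨fun j => ?_, hN⟩
      have := Finset.single_le_sum (f := N) (fun _ _ => Nat.zero_le _) (Finset.mem_univ j)
      omega
    · refine Finset.mem_product.2 ⟨mem_sortedWords.2 ⟨hcol, fun j => rfl⟩,
        mem_sortedWords.2 ⟨hrow, fun j => ?_⟩⟩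
      refine Finset.card_bij (fun v _ => π.symm v) ?_ ?_ ?_
      · intro v hv
        simpa using hv
      · intro v _ v' _ h
        exact π.symm.injective h
      · intro i hi
        exact ⟨π i, by simpa using hi, by simp⟩
    · intro i
      simp
  calc (gridSet M n).ncard ≤ (⋃ N ∈ T, ⋃ p ∈ Z N, G p).ncard :=
        Set.ncard_le_ncard hsub (Set.toFinite _)
    _ ≤ ∑ N ∈ T, (⋃ p ∈ Z N, G p).ncard := Finset.set_ncard_biUnion_le _ _
    _ ≤ ∑ N ∈ T, ∑ p ∈ Z N, ∏ j, (withEmpty (F j) (N j)).ncard := by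
        refine Finset.sum_le_sum fun N _ => (Finset.set_ncard_biUnion_le _ _).trans ?_
        refine Finset.sum_le_sum fun p hp => ?_
        obtain ⟨h1, h2⟩ := Finset.mem_product.1 hp
        exact ncard_perms_with_words_le (mem_sortedWords.1 h1).2 (mem_sortedWords.1 h2).2 _
    _ = _ := by
        refine Finset.sum_congr rfl fun N _ => ?_
        rw [Finset.sum_const, Finset.card_product, smul_eq_mul]

lemma le_ncard_gridSet (hpos : Function.Injective pos)
    (hM : ∀ j, M (pos j).1 (pos j).2 = F j) (n : ℕ) (N : κ → ℕ) :
    (sortedWords n (fun j => (pos j).1) N).card * (sortedWords n (fun j => (pos j).2) N).card *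
        ∏ j, (withEmpty (F j) (N j)).ncard ≤ (gridSet M n).ncard := by
  let Z := (sortedWords n (fun j => (pos j).1) N ×ˢ sortedWords n (fun j => (pos j).2) N) ×ˢ
    patternChoices (fun j => withEmpty (F j)) N
  have hex : ∀ z ∈ Z, ∃ π ∈ gridSet M n, (∀ i, z.1.2 (π i) = z.1.1 i) ∧
      ∀ (h : ∀ j, (Finset.univ.filter fun i => z.1.1 i = j).card = N j) j a b,
        z.2 j a < z.2 j b ↔ π (letterEnum h j a) < π (letterEnum h j b) := by
    rintro ⟨⟨W, V⟩, σ⟩ hz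
    obtain ⟨hWV, hσ⟩ := Finset.mem_product.1 hz
    obtain ⟨hW, hV⟩ := Finset.mem_product.1 hWV
    dsimp only at hW hV hσ ⊢
    have hW' := mem_sortedWords.1 hW
    have hV' := mem_sortedWords.1 hV
    obtain ⟨π, h1, h2⟩ := exists_perm_of_patterns hW'.2 hV'.2 σ
    refine ⟨π, ?_, h1, fun h => h2⟩
    refine mem_gridSet_of_labelling hM W hW'.1 ?_ ?_
    · have : ∀ v, W (π.symm v) = V v := fun v => by rw [← h1, Equiv.apply_symm_apply]
      simpa only [this] using hV'.1
    · intro j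
      simp only [hpos.eq_iff]
      exact ⟨N j, σ j, letterEnum hW'.2 j, range_letterEnum _ _, h2 j,
        mem_patternChoices.1 hσ j⟩
  choose! g hg hg1 hg2 using hex
  have hcard : Z.card = (sortedWords n (fun j => (pos j).1) N).card *
      (sortedWords n (fun j => (pos j).2) N).card * ∏ j, (withEmpty (F j) (N j)).ncard := by
    rw [Finset.card_product, Finset.card_product, card_patternChoices]
  rw [← hcard, ← Set.ncard_coe_finset]
  refine Set.ncard_le_ncard_of_injOn g (fun z hz => hg z hz) ?_ (Set.toFinite _)
  rintro ⟨⟨W, V⟩, σ⟩ hz ⟨⟨W', V'⟩, σ'⟩ hz' h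
  have e1 := hg1 _ hz
  have e1' := hg1 _ hz'
  have e2 := hg2 _ hz
  have e2' := hg2 _ hz'
  obtain ⟨hWV, -⟩ := Finset.mem_product.1 (Finset.mem_coe.1 hz)
  obtain ⟨hW, hV⟩ := Finset.mem_product.1 hWV
  obtain ⟨hWV', -⟩ := Finset.mem_product.1 (Finset.mem_coe.1 hz')
  obtain ⟨hW', hV'⟩ := Finset.mem_product.1 hWV'
  rw [← h] at e1' e2'
  generalize g ((W, V), σ) = π at e1 e1' e2 e2'
  dsimp only at e1 e1' e2 e2' hW hV hW' hV'
  have hWW : W = W' := by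
    funext i
    refine hpos (Prod.ext (key_eq_of_mem_sortedWords hW hW' i) ?_)
    rw [← e1, ← e1']
    exact key_eq_of_mem_sortedWords hV hV' (π i)
  have hVV : V = V' := by
    funext v
    have h1 := e1 (π.symm v)
    have h2 := e1' (π.symm v)
    rw [Equiv.apply_symm_apply] at h1 h2
    rw [h1, h2, hWW]
  subst hWW hVV
  have hσσ : σ = σ' := by
    funext j
    have hc := (mem_sortedWords.1 hW).2
    exact perm_eq_of_lt_iff_lt fun a b => (e2 hc j a b).trans (e2' hc j a b).symm
  rw [hσσ]

end Counting

section Growth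

lemma growthSeq_nonneg (F : ∀ m, Set (Perm m)) (n : ℕ) : 0 ≤ growthSeq F n := by
  unfold growthSeq
  positivity

lemma HasGrowth.nonneg {F : ∀ m, Set (Perm m)} {g : ℝ} (h : HasGrowth F g) : 0 ≤ g :=
  ge_of_tendsto' h (growthSeq_nonneg F)

lemma HasGrowth.withEmpty {F : ∀ m, Set (Perm m)} {g : ℝ} (h : HasGrowth F g) :
    HasGrowth (withEmpty F) g := by
  refine Tendsto.congr' ?_ h
  filter_upwards [eventually_ne_atTop 0] with n hn
  unfold growthSeq _root_.withEmpty
  simp [hn]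

lemma ncard_withEmpty_zero (F : ∀ m, Set (Perm m)) : (withEmpty F 0).ncard = 1 := by
  have : withEmpty F 0 = Set.univ := Set.eq_univ_of_forall fun σ => Or.inl rfl
  rw [this, Set.ncard_univ, Nat.card_eq_fintype_card, Fintype.card_perm]
  simp

lemma growthSeq_pow {F : ∀ m, Set (Perm m)} {n : ℕ} (hn : n ≠ 0) :
    growthSeq F n ^ n = (F n).ncard :=
  Real.rpow_inv_natCast_pow (Nat.cast_nonneg _) hn

lemma HasGrowth.exists_le_mul_pow {F : ∀ m, Set (Perm m)} {g y : ℝ} (h : HasGrowth F g)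
    (hy : g < y) : ∃ K : ℝ, 0 < K ∧ ∀ m, ((F m).ncard : ℝ) ≤ K * y ^ m := by
  have hy0 : 0 < y := h.nonneg.trans_lt hy
  obtain ⟨m₀, hm₀⟩ := eventually_atTop.1 ((h.eventually_lt_const hy).and (eventually_ne_atTop 0))
  refine ⟨1 + ∑ m ∈ Finset.range m₀, ((F m).ncard : ℝ) / y ^ m, by positivity, fun m => ?_⟩
  have hs : 0 ≤ ∑ m ∈ Finset.range m₀, ((F m).ncard : ℝ) / y ^ m :=
    Finset.sum_nonneg fun _ _ => by positivity
  rcases lt_or_ge m m₀ with hm | hm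
  · have h1 : ((F m).ncard : ℝ) / y ^ m ≤ ∑ m ∈ Finset.range m₀, ((F m).ncard : ℝ) / y ^ m :=
      Finset.single_le_sum (f := fun m => ((F m).ncard : ℝ) / y ^ m)
        (fun _ _ => by positivity) (Finset.mem_range.2 hm)
    rw [← div_le_iff₀ (by positivity)]
    linarith
  · obtain ⟨h1, h2⟩ := hm₀ m hm
    rw [← growthSeq_pow h2]
    calc growthSeq F m ^ m ≤ y ^ m := pow_le_pow_left₀ (growthSeq_nonneg F m) h1.le m
      _ = 1 * y ^ m := (one_mul _).symm
      _ ≤ _ := mul_le_mul_of_nonneg_right (by linarith) (by positivity)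

lemma tendsto_succ_rpow_inv :
    Tendsto (fun n : ℕ => ((n : ℝ) + 1) ^ ((n : ℝ)⁻¹)) atTop (𝓝 1) := by
  have h := (tendsto_rpow_div_mul_add 1 1 (-1) (by norm_num)).comp
    (tendsto_atTop_add_const_right atTop (1 : ℝ) tendsto_natCast_atTop_atTop)
  refine h.congr fun n => ?_
  simp [Function.comp]

lemma tendsto_const_rpow_inv {K : ℝ} (hK : 0 < K) :
    Tendsto (fun n : ℕ => K ^ ((n : ℝ)⁻¹)) atTop (𝓝 1) := by
  have := (tendsto_const_nhds (x := K)).rpow (tendsto_inv_atTop_nhds_zero_nat (𝕜 := ℝ))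
    (Or.inl hK.ne')
  simpa using this

variable {κ : Type*} [Fintype κ] [DecidableEq κ]
variable {M : ℕ → ℕ → ∀ m, Set (Perm m)} {pos : κ → ℕ × ℕ} {F : κ → ∀ m, Set (Perm m)}

lemma ncard_gridSet_le_pow (hpos : Function.Injective pos)
    (hM : ∀ j, M (pos j).1 (pos j).2 = F j)
    (hM' : ∀ k l, (∀ j, pos j ≠ (k, l)) → M k l = emptyCell)
    {α y : κ → ℝ} {lam K : ℝ} (hα : ∀ j, 0 < α j)
    (hlam : ∀ j, y j * ((∑ j' with (pos j').1 = (pos j).1, α j') *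
      ∑ j' with (pos j').2 = (pos j).2, α j') = lam * α j ^ 2) (hK : 0 ≤ K)
    (hF : ∀ j m, ((withEmpty (F j) m).ncard : ℝ) ≤ K * y j ^ m) (hlam0 : 0 ≤ lam) (n : ℕ) :
    ((gridSet M n).ncard : ℝ) ≤
      ((n : ℝ) + 1) ^ Fintype.card κ * (K ^ Fintype.card κ * lam ^ n) := by
  let S : (κ → ℕ) → κ → ℝ := fun key j => ∑ j' with key j' = key j, α j'
  have hS : ∀ key j, 0 < S key j := fun key j =>
    Finset.sum_pos (fun j' _ => hα j') ⟨j, by simp⟩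
  have hq : ∀ (key : κ → ℕ) N, ((sortedWords n key N).card : ℝ) *
      ∏ j, (α j / S key j) ^ N j ≤ 1 := by
    intro key N
    refine card_sortedWords_mul_le (fun j => (div_pos (hα j) (hS key j)).le) fun v => ?_
    have : ∑ j with key j = v, α j / S key j
        = (∑ j with key j = v, α j) / ∑ j with key j = v, α j := by
      rw [Finset.sum_div]
      refine Finset.sum_congr rfl fun j hj => ?_
      simp only [S, (Finset.mem_filter.1 hj).2]
    rw [this]
    exact div_self_le_one _
  have hy' : ∀ j, y j = lam * ((α j / S (fun j => (pos j).1) j) *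
      (α j / S (fun j => (pos j).2) j)) := by
    intro j
    have h1 := hS (fun j => (pos j).1) j
    have h2 := hS (fun j => (pos j).2) j
    have h3 : y j * (S (fun j => (pos j).1) j * S (fun j => (pos j).2) j) = lam * α j ^ 2 :=
      hlam j
    field_simp
    linarith
  have hterm : ∀ N : κ → ℕ, ∑ j, N j = n →
      ((sortedWords n (fun j => (pos j).1) N).card : ℝ) *
        (sortedWords n (fun j => (pos j).2) N).card * ∏ j, ((withEmpty (F j) (N j)).ncard : ℝ)
      ≤ K ^ Fintype.card κ * lam ^ n := by
    intro N hN
    have h1 := hq (fun j => (pos j).1) N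
    have h2 := hq (fun j => (pos j).2) N
    have hnn : ∀ key : κ → ℕ, 0 ≤ ((sortedWords n key N).card : ℝ) *
        ∏ j, (α j / S key j) ^ N j := fun key =>
      mul_nonneg (Nat.cast_nonneg _)
        (Finset.prod_nonneg fun j _ => pow_nonneg (div_pos (hα j) (hS key j)).le _)
    have h3 : ∏ j, ((withEmpty (F j) (N j)).ncard : ℝ) ≤ K ^ Fintype.card κ * (lam ^ n *
        ((∏ j, (α j / S (fun j => (pos j).1) j) ^ N j) *
          ∏ j, (α j / S (fun j => (pos j).2) j) ^ N j)) := by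
      calc ∏ j, ((withEmpty (F j) (N j)).ncard : ℝ) ≤ ∏ j, K * y j ^ N j :=
            Finset.prod_le_prod (fun _ _ => Nat.cast_nonneg _) fun j _ => hF j (N j)
        _ = _ := by
            rw [Finset.prod_mul_distrib, Finset.prod_const, Finset.card_univ]
            congr 1
            rw [← hN, ← Finset.prod_pow_eq_pow_sum, ← Finset.prod_mul_distrib,
              ← Finset.prod_mul_distrib]
            refine Finset.prod_congr rfl fun j _ => ?_
            rw [hy' j, mul_pow, mul_pow]
    calc _ ≤ ((sortedWords n (fun j => (pos j).1) N).card : ℝ) *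
          (sortedWords n (fun j => (pos j).2) N).card * (K ^ Fintype.card κ * (lam ^ n *
        ((∏ j, (α j / S (fun j => (pos j).1) j) ^ N j) *
          ∏ j, (α j / S (fun j => (pos j).2) j) ^ N j))) :=
          mul_le_mul_of_nonneg_left h3 (by positivity)
      _ = K ^ Fintype.card κ * lam ^ n * ((((sortedWords n (fun j => (pos j).1) N).card : ℝ) *
            ∏ j, (α j / S (fun j => (pos j).1) j) ^ N j) *
          (((sortedWords n (fun j => (pos j).2) N).card : ℝ) *
            ∏ j, (α j / S (fun j => (pos j).2) j) ^ N j)) := by ring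
      _ ≤ K ^ Fintype.card κ * lam ^ n * 1 := by
          refine mul_le_mul_of_nonneg_left ?_ (by positivity)
          exact mul_le_one₀ h1 (hnn _) h2
      _ = _ := mul_one _
  have hle := ncard_gridSet_le hpos hM hM' n
  calc ((gridSet M n).ncard : ℝ) ≤ _ := Nat.cast_le.2 hle
    _ ≤ ∑ N ∈ Fintype.piFinset (fun _ : κ => Finset.range (n + 1)) with
        ∑ j, N j = n, K ^ Fintype.card κ * lam ^ n := by
        push_cast
        exact Finset.sum_le_sum fun N hN => hterm N (Finset.mem_filter.1 hN).2
    _ ≤ ∑ N ∈ Fintype.piFinset (fun _ : κ => Finset.range (n + 1)),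
        K ^ Fintype.card κ * lam ^ n :=
        Finset.sum_le_sum_of_subset_of_nonneg (Finset.filter_subset _ _)
          fun _ _ _ => by positivity
    _ = _ := by
        rw [Finset.sum_const, Fintype.card_piFinset, Finset.prod_const, Finset.card_univ,
          Finset.card_range, nsmul_eq_mul]
        push_cast
        ring

lemma eventually_growthSeq_gridSet_lt (hpos : Function.Injective pos)
    (hM : ∀ j, M (pos j).1 (pos j).2 = F j)
    (hM' : ∀ k l, (∀ j, pos j ≠ (k, l)) → M k l = emptyCell)
    {α g y : κ → ℝ} {lam μ : ℝ} (hα : ∀ j, 0 < α j)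
    (hlam : ∀ j, y j * ((∑ j' with (pos j').1 = (pos j).1, α j') *
      ∑ j' with (pos j').2 = (pos j).2, α j') = lam * α j ^ 2)
    (hF : ∀ j, HasGrowth (F j) (g j)) (hy : ∀ j, g j < y j) (hlam0 : 0 ≤ lam) (hμ : lam < μ) :
    ∀ᶠ n in atTop, growthSeq (gridSet M) n < μ := by
  have hy0 : ∀ j, 0 ≤ y j := fun j => (hF j).nonneg.trans (hy j).le
  choose K hK hKF using fun j => (hF j).withEmpty.exists_le_mul_pow (hy j)
  let K' := 1 + ∑ j, K j
  have hK' : 0 < K' := by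
    have := Finset.sum_nonneg fun j (_ : j ∈ Finset.univ) => (hK j).le
    positivity
  have hKK : ∀ j, K j ≤ K' := fun j => by
    have := Finset.single_le_sum (f := K) (fun j _ => (hK j).le) (Finset.mem_univ j)
    simp only [K']
    linarith
  have hbound := ncard_gridSet_le_pow hpos hM hM' hα hlam hK'.le
    (fun j m => (hKF j m).trans (mul_le_mul_of_nonneg_right (hKK j) (pow_nonneg (hy0 j) m))) hlam0
  have hlim : Tendsto (fun n : ℕ => (((n : ℝ) + 1) ^ ((n : ℝ)⁻¹)) ^ Fintype.card κ *
      ((K' ^ Fintype.card κ) ^ ((n : ℝ)⁻¹) * lam)) atTop (𝓝 (1 ^ Fintype.card κ * (1 * lam))) :=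
    (tendsto_succ_rpow_inv.pow _).mul
      ((tendsto_const_rpow_inv (pow_pos hK' _)).mul tendsto_const_nhds)
  rw [one_pow, one_mul, one_mul] at hlim
  filter_upwards [hlim.eventually_lt_const hμ, eventually_ne_atTop 0] with n hn hn0
  refine lt_of_le_of_lt ?_ hn
  calc growthSeq (gridSet M) n ≤ (((n : ℝ) + 1) ^ Fintype.card κ *
        (K' ^ Fintype.card κ * lam ^ n)) ^ ((n : ℝ)⁻¹) :=
        Real.rpow_le_rpow (Nat.cast_nonneg _) (hbound n) (by positivity)
    _ = _ := by
        rw [Real.mul_rpow (by positivity) (by positivity),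
          Real.mul_rpow (by positivity) (by positivity), Real.pow_rpow_inv_natCast hlam0 hn0]
        congr 1
        rw [← Real.rpow_natCast, ← Real.rpow_natCast, ← Real.rpow_mul (by positivity),
          ← Real.rpow_mul (by positivity), mul_comm]

lemma growthSeq_withEmpty_le (hpos : Function.Injective pos)
    (hM : ∀ j, M (pos j).1 (pos j).2 = F j) (j₀ : κ) (n : ℕ) :
    growthSeq (withEmpty (F j₀)) n ≤ growthSeq (gridSet M) n := by
  refine Real.rpow_le_rpow (Nat.cast_nonneg _) (Nat.cast_le.2 ?_) (by positivity)
  let N : κ → ℕ := Pi.single j₀ n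
  have hN : ∑ j, N j = n := by simp [N]
  have h := le_ncard_gridSet hpos hM n N
  have h1 := (sortedWords_nonempty (fun j => (pos j).1) hN).card_pos
  have h2 := (sortedWords_nonempty (fun j => (pos j).2) hN).card_pos
  have h3 : ∏ j, (withEmpty (F j) (N j)).ncard = (withEmpty (F j₀) n).ncard := by
    rw [Finset.prod_eq_single j₀]
    · rw [show N j₀ = n from Pi.single_eq_same _ _]
    · intro j _ hj
      rw [show N j = 0 from Pi.single_eq_of_ne hj _]
      exact ncard_withEmpty_zero _
    · simp
  rw [h3] at h
  exact (Nat.le_mul_of_pos_left _ (Nat.mul_pos h1 h2)).trans h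

lemma exists_approx_counts [Nonempty κ] {α : κ → ℝ} (hα : ∀ j, 0 < α j) (hsum : ∑ j, α j = 1) :
    ∃ N : ℕ → κ → ℕ, (∀ n, ∑ j, N n j = n) ∧
      ∀ j, Tendsto (fun n => (N n j : ℝ) / n) atTop (𝓝 (α j)) := by
  obtain ⟨j₀⟩ := ‹Nonempty κ›
  let R : ℕ → ℕ := fun n => ∑ j ∈ Finset.univ.erase j₀, ⌊α j * n⌋₊
  have hα0 : ∑ j ∈ Finset.univ.erase j₀, α j = 1 - α j₀ := by
    rw [← hsum, ← Finset.add_sum_erase _ _ (Finset.mem_univ j₀)]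
    ring
  have hR : ∀ n, R n ≤ n := by
    intro n
    have : (R n : ℝ) ≤ n := by
      calc (R n : ℝ) ≤ ∑ j ∈ Finset.univ.erase j₀, α j * n := by
            simp only [R]
            push_cast
            exact Finset.sum_le_sum fun j _ => Nat.floor_le (by have := hα j; positivity)
        _ = (1 - α j₀) * n := by rw [← Finset.sum_mul, hα0]
        _ ≤ n := by
            have := mul_nonneg (hα j₀).le (Nat.cast_nonneg (α := ℝ) n)
            linarith
    exact_mod_cast this
  have hfl : ∀ j, Tendsto (fun n : ℕ => (⌊α j * n⌋₊ : ℝ) / n) atTop (𝓝 (α j)) := fun j =>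
    (tendsto_nat_floor_mul_div_atTop (hα j).le).comp tendsto_natCast_atTop_atTop
  refine ⟨fun n j => if j = j₀ then n - R n else ⌊α j * n⌋₊, ?_, ?_⟩
  · intro n
    rw [← Finset.add_sum_erase _ _ (Finset.mem_univ j₀)]
    beta_reduce
    rw [if_pos rfl]
    rw [Finset.sum_congr rfl fun j hj => if_neg (Finset.ne_of_mem_erase hj)]
    have := hR n
    simp only [R] at this ⊢
    omega
  · intro j
    by_cases hj : j = j₀
    · subst hj
      simp only [if_true]
      have hlim : Tendsto (fun n : ℕ => 1 - ∑ j' ∈ Finset.univ.erase j, (⌊α j' * n⌋₊ : ℝ) / n)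
          atTop (𝓝 (1 - ∑ j' ∈ Finset.univ.erase j, α j')) :=
        tendsto_const_nhds.sub (tendsto_finsetSum _ fun j' _ => hfl j')
      rw [hα0, _root_.sub_sub_cancel] at hlim
      refine hlim.congr' ?_
      filter_upwards [eventually_ne_atTop 0] with n hn
      have hn' : (n : ℝ) ≠ 0 := Nat.cast_ne_zero.2 hn
      rw [Nat.cast_sub (hR n), sub_div, div_self hn', ← Finset.sum_div]
      simp only [R]
      push_cast
      rfl
    · simp only [if_neg hj]
      exact hfl j

end Growth

section LowerBound

variable {κ : Type*} [Fintype κ] [DecidableEq κ]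
variable {M : ℕ → ℕ → ∀ m, Set (Perm m)} {pos : κ → ℕ × ℕ} {F : κ → ∀ m, Set (Perm m)}

lemma prod_div_pow_le_card_sortedWords {n : ℕ} {key : κ → ℕ} {N : κ → ℕ} (hN : ∑ j, N j = n)
    (P : κ → Prop) (hP : ∀ j j', key j = key j' → (P j ↔ P j') → j = j') (hpos : ∀ j, 0 < N j) :
    ∏ j, (((∑ j' with key j' = key j, N j' : ℕ) : ℝ) / N j) ^ N j
      ≤ ((n : ℝ) + 1) ^ Fintype.card κ * (sortedWords n key N).card := by
  classical
  have h := prod_pow_le_card_sortedWords_mul hN P hP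
  have hpos' : ∀ j, (0 : ℝ) < N j := fun j => Nat.cast_pos.2 (hpos j)
  simp only [div_pow]
  rw [Finset.prod_div_distrib, div_le_iff₀ (Finset.prod_pos fun j _ => pow_pos (hpos' j) _),
    mul_assoc]
  exact_mod_cast h

lemma growthSeq_gridSet_ge (hpos : Function.Injective pos)
    (hM : ∀ j, M (pos j).1 (pos j).2 = F j) (Pc Pr : κ → Prop)
    (hPc : ∀ j j', (pos j).1 = (pos j').1 → (Pc j ↔ Pc j') → j = j')
    (hPr : ∀ j j', (pos j).2 = (pos j').2 → (Pr j ↔ Pr j') → j = j')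
    {n : ℕ} {N : κ → ℕ} (hN : ∑ j, N j = n) (hN0 : ∀ j, 0 < N j) (hn : n ≠ 0) :
    ∏ j, (growthSeq (withEmpty (F j)) (N j) *
      ((((∑ j' with (pos j').1 = (pos j).1, N j' : ℕ) : ℝ) / N j) *
        (((∑ j' with (pos j').2 = (pos j).2, N j' : ℕ) : ℝ) / N j))) ^ ((N j : ℝ) / n)
      ≤ ((((n : ℝ) + 1) ^ ((n : ℝ)⁻¹)) ^ Fintype.card κ) ^ 2 * growthSeq (gridSet M) n := by
  let S : (κ → ℕ) → κ → ℝ := fun key j => ((∑ j' with key j' = key j, N j' : ℕ) : ℝ) / N j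
  have hS : ∀ key j, 0 ≤ S key j := fun key j => by positivity
  have hc := prod_div_pow_le_card_sortedWords hN Pc hPc hN0
  have hr := prod_div_pow_le_card_sortedWords hN Pr hPr hN0
  have hgrid : (((sortedWords n (fun j => (pos j).1) N).card : ℝ) *
      (sortedWords n (fun j => (pos j).2) N).card * ∏ j, ((withEmpty (F j) (N j)).ncard : ℝ))
      ≤ (gridSet M n).ncard := by
    exact_mod_cast le_ncard_gridSet hpos hM n N
  have hmain : ∏ j, (growthSeq (withEmpty (F j)) (N j) *
      (S (fun j => (pos j).1) j * S (fun j => (pos j).2) j)) ^ N j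
      ≤ (((n : ℝ) + 1) ^ Fintype.card κ) ^ 2 * (gridSet M n).ncard := by
    simp only [mul_pow]
    rw [Finset.prod_mul_distrib, Finset.prod_mul_distrib,
      Finset.prod_congr rfl fun j _ => growthSeq_pow (F := withEmpty (F j)) (hN0 j).ne']
    calc _ ≤ (∏ j, ((withEmpty (F j) (N j)).ncard : ℝ)) *
          ((((n : ℝ) + 1) ^ Fintype.card κ * (sortedWords n (fun j => (pos j).1) N).card) *
          (((n : ℝ) + 1) ^ Fintype.card κ * (sortedWords n (fun j => (pos j).2) N).card)) := by
          refine mul_le_mul_of_nonneg_left (mul_le_mul hc hr ?_ (by positivity)) ?_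
          · exact Finset.prod_nonneg fun j _ => pow_nonneg (hS _ j) _
          · exact Finset.prod_nonneg fun j _ => Nat.cast_nonneg _
      _ = (((n : ℝ) + 1) ^ Fintype.card κ) ^ 2 *
          (((sortedWords n (fun j => (pos j).1) N).card : ℝ) *
            (sortedWords n (fun j => (pos j).2) N).card *
            ∏ j, ((withEmpty (F j) (N j)).ncard : ℝ)) := by ring
      _ ≤ _ := mul_le_mul_of_nonneg_left hgrid (by positivity)
  have hnn : ∀ j, 0 ≤ growthSeq (withEmpty (F j)) (N j) *
      (S (fun j => (pos j).1) j * S (fun j => (pos j).2) j) := fun j =>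
    mul_nonneg (growthSeq_nonneg _ _) (mul_nonneg (hS _ j) (hS _ j))
  calc _ = (∏ j, (growthSeq (withEmpty (F j)) (N j) *
      (S (fun j => (pos j).1) j * S (fun j => (pos j).2) j)) ^ N j) ^ ((n : ℝ)⁻¹) := by
        rw [← Real.finsetProd_rpow _ _ fun j _ => pow_nonneg (hnn j) _]
        refine Finset.prod_congr rfl fun j _ => ?_
        rw [← Real.rpow_natCast, ← Real.rpow_mul (hnn j), div_eq_mul_inv (N j : ℝ)]
    _ ≤ ((((n : ℝ) + 1) ^ Fintype.card κ) ^ 2 * (gridSet M n).ncard) ^ ((n : ℝ)⁻¹) :=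
        Real.rpow_le_rpow (Finset.prod_nonneg fun j _ => pow_nonneg (hnn j) _) hmain
          (by positivity)
    _ = _ := by
        rw [Real.mul_rpow (by positivity) (Nat.cast_nonneg _)]
        congr 1
        rw [← pow_mul, ← pow_mul, ← Real.rpow_natCast, ← Real.rpow_natCast,
          ← Real.rpow_mul (by positivity), ← Real.rpow_mul (by positivity), mul_comm]

lemma eventually_lt_growthSeq_gridSet [Nonempty κ] (hpos : Function.Injective pos)
    (hM : ∀ j, M (pos j).1 (pos j).2 = F j) (Pc Pr : κ → Prop)
    (hPc : ∀ j j', (pos j).1 = (pos j').1 → (Pc j ↔ Pc j') → j = j')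
    (hPr : ∀ j j', (pos j).2 = (pos j').2 → (Pr j ↔ Pr j') → j = j')
    {α g : κ → ℝ} {lam μ : ℝ} (hα : ∀ j, 0 < α j)
    (hlam : ∀ j, g j * ((∑ j' with (pos j').1 = (pos j).1, α j') *
      ∑ j' with (pos j').2 = (pos j).2, α j') = lam * α j ^ 2)
    (hg : ∀ j, 0 < g j) (hF : ∀ j, HasGrowth (F j) (g j)) (hμ : μ < lam) :
    ∀ᶠ n in atTop, μ < growthSeq (gridSet M) n := by
  have hs : 0 < ∑ j, α j := Finset.sum_pos (fun j _ => hα j) Finset.univ_nonempty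
  let β : κ → ℝ := fun j => α j / ∑ j, α j
  have hβ : ∀ j, 0 < β j := fun j => div_pos (hα j) hs
  have hβ1 : ∑ j, β j = 1 := by
    simp only [β]
    rw [← Finset.sum_div, div_self hs.ne']
  have hβS : ∀ key : κ → ℕ, ∀ j,
      0 < ∑ j' with key j' = key j, β j' := fun key j =>
    Finset.sum_pos (fun j' _ => hβ j') ⟨j, by simp⟩
  have hβlam : ∀ j, g j * (((∑ j' with (pos j').1 = (pos j).1, β j') / β j) *
      ((∑ j' with (pos j').2 = (pos j).2, β j') / β j)) = lam := by
    intro j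
    have h := hlam j
    have hj := hα j
    simp only [β]
    rw [← Finset.sum_div, ← Finset.sum_div]
    field_simp
    linarith
  have hlam0 : 0 < lam := by
    obtain ⟨j⟩ := ‹Nonempty κ›
    rw [← hβlam j]
    have h1 := hβS (fun j => (pos j).1) j
    have h2 := hβS (fun j => (pos j).2) j
    have h3 := hβ j
    have h4 := hg j
    positivity
  obtain ⟨N, hN, hNlim⟩ := exists_approx_counts hβ hβ1
  have hNtop : ∀ j, Tendsto (fun n => N n j) atTop atTop := by
    intro j
    have h1 : Tendsto (fun n : ℕ => (N n j : ℝ) / n * n) atTop atTop :=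
      (hNlim j).pos_mul_atTop (hβ j) tendsto_natCast_atTop_atTop
    rw [← tendsto_natCast_atTop_iff (R := ℝ)]
    refine h1.congr' ?_
    filter_upwards [eventually_ne_atTop 0] with n hn
    exact div_mul_cancel₀ _ (Nat.cast_ne_zero.2 hn)
  have hratio : ∀ (key : κ → ℕ) j, Tendsto
      (fun n => ((∑ j' with key j' = key j, N n j' : ℕ) : ℝ) / N n j) atTop
      (𝓝 ((∑ j' with key j' = key j, β j') / β j)) := by
    intro key j
    have h1 : Tendsto (fun n : ℕ => (∑ j' with key j' = key j, (N n j' : ℝ) / n) /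
        ((N n j : ℝ) / n)) atTop (𝓝 ((∑ j' with key j' = key j, β j') / β j)) :=
      (tendsto_finsetSum _ fun j' _ => hNlim j').div (hNlim j) (hβ j).ne'
    refine h1.congr' ?_
    filter_upwards [eventually_ne_atTop 0] with n hn
    have hn' : (n : ℝ) ≠ 0 := Nat.cast_ne_zero.2 hn
    rw [← Finset.sum_div, div_div_div_cancel_right₀ hn']
    push_cast
    rfl
  have hlim : Tendsto (fun n => ∏ j, (growthSeq (withEmpty (F j)) (N n j) *
      ((((∑ j' with (pos j').1 = (pos j).1, N n j' : ℕ) : ℝ) / N n j) *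
        (((∑ j' with (pos j').2 = (pos j).2, N n j' : ℕ) : ℝ) / N n j))) ^ ((N n j : ℝ) / n))
      atTop (𝓝 lam) := by
    have h1 : Tendsto (fun n => ∏ j, (growthSeq (withEmpty (F j)) (N n j) *
      ((((∑ j' with (pos j').1 = (pos j).1, N n j' : ℕ) : ℝ) / N n j) *
        (((∑ j' with (pos j').2 = (pos j).2, N n j' : ℕ) : ℝ) / N n j))) ^ ((N n j : ℝ) / n))
        atTop (𝓝 (∏ j, lam ^ β j)) := by
      refine tendsto_finsetProd _ fun j _ => Tendsto.rpow ?_ (hNlim j) (Or.inl hlam0.ne')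
      rw [← hβlam j]
      exact ((hF j).withEmpty.comp (hNtop j)).mul
        ((hratio (fun j => (pos j).1) j).mul (hratio (fun j => (pos j).2) j))
    rwa [← Real.rpow_sum_of_pos hlam0, hβ1, Real.rpow_one] at h1
  have hpoly : Tendsto (fun n : ℕ => ((((n : ℝ) + 1) ^ ((n : ℝ)⁻¹)) ^ Fintype.card κ) ^ 2)
      atTop (𝓝 ((1 ^ Fintype.card κ) ^ 2)) := (tendsto_succ_rpow_inv.pow _).pow _
  rw [one_pow, one_pow] at hpoly
  have hquot := hlim.div hpoly one_ne_zero
  rw [_root_.div_one] at hquot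
  filter_upwards [hquot.eventually_const_lt hμ, eventually_ne_atTop 0,
    eventually_all.2 fun j => (hNtop j).eventually_gt_atTop 0] with n h1 h2 h3
  refine h1.trans_le ?_
  rw [Pi.div_apply, div_le_iff₀' (by positivity)]
  exact growthSeq_gridSet_ge hpos hM Pc Pr hPc hPr (hN n) h3 h2

end LowerBound

section Staircase

/-- The positive eigenvector of the row-column graph of the staircase on the rows. -/
noncomputable def rowWeight (t : ℕ) (k : ℕ) : ℝ := Real.sin (k * (Real.pi / (t + 1)))

/-- The positive eigenvector of the row-column graph of the staircase on the columns (up to a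
constant factor). -/
noncomputable def colWeight (a b : ℝ) (t : ℕ) (k : ℕ) : ℝ :=
  b * rowWeight t k + a * rowWeight t (k + 1)

/-- The asymptotic proportions (up to a constant factor) of the entries in the cells of the
staircase. -/
noncomputable def cellWeight (a b : ℝ) (t : ℕ) (j : ℕ) : ℝ :=
  if Even j then a * colWeight a b t (j / 2) * rowWeight t (j / 2 + 1)
  else b * rowWeight t (j / 2 + 1) * colWeight a b t (j / 2 + 1)

lemma rowWeight_zero (t : ℕ) : rowWeight t 0 = 0 := by simp [rowWeight]

lemma rowWeight_succ_self (t : ℕ) : rowWeight t (t + 1) = 0 := by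
  have : ((t + 1 : ℕ) : ℝ) * (Real.pi / (t + 1)) = Real.pi := by
    push_cast
    field_simp
  rw [rowWeight, this, Real.sin_pi]

lemma rowWeight_pos {t k : ℕ} (h0 : 0 < k) (h1 : k ≤ t) : 0 < rowWeight t k := by
  have hk : (0 : ℝ) < k := Nat.cast_pos.2 h0
  have hkt : (k : ℝ) ≤ t := Nat.cast_le.2 h1
  refine Real.sin_pos_of_pos_of_lt_pi (by positivity) ?_
  rw [mul_div_assoc', div_lt_iff₀ (by positivity), mul_comm]
  exact mul_lt_mul_of_pos_left (by linarith) Real.pi_pos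

lemma rowWeight_nonneg {t k : ℕ} (h : k ≤ t + 1) : 0 ≤ rowWeight t k := by
  rcases Nat.eq_zero_or_pos k with rfl | h0
  · rw [rowWeight_zero]
  · rcases h.eq_or_lt with rfl | h1
    · rw [rowWeight_succ_self]
    · exact (rowWeight_pos h0 (by omega)).le

lemma rowWeight_add_rowWeight (t k : ℕ) :
    rowWeight t k + rowWeight t (k + 2)
      = 2 * Real.cos (Real.pi / (t + 1)) * rowWeight t (k + 1) := by
  have h1 : ((k : ℕ) : ℝ) * (Real.pi / (t + 1))
      = ((k + 1 : ℕ) : ℝ) * (Real.pi / (t + 1)) - Real.pi / (t + 1) := by push_cast; ring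
  have h2 : ((k + 2 : ℕ) : ℝ) * (Real.pi / (t + 1))
      = ((k + 1 : ℕ) : ℝ) * (Real.pi / (t + 1)) + Real.pi / (t + 1) := by push_cast; ring
  unfold rowWeight
  rw [h1, h2, Real.sin_sub, Real.sin_add]
  ring

variable {a b : ℝ} {t : ℕ}

lemma colWeight_pos (ha : 0 < a) (hb : 0 < b) (ht : 1 ≤ t) {k : ℕ} (hk : k ≤ t) :
    0 < colWeight a b t k := by
  unfold colWeight
  rcases Nat.eq_zero_or_pos k with rfl | h0
  · rw [rowWeight_zero, mul_zero, zero_add]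
    exact mul_pos ha (rowWeight_pos one_pos ht)
  · exact add_pos_of_pos_of_nonneg (mul_pos hb (rowWeight_pos h0 hk))
      (mul_nonneg ha.le (rowWeight_nonneg (by omega)))

lemma cellWeight_pos (ha : 0 < a) (hb : 0 < b) (ht : 1 ≤ t) {j : ℕ} (hj : j < 2 * t) :
    0 < cellWeight a b t j := by
  have h1 := colWeight_pos ha hb ht (k := j / 2) (by omega)
  have h2 := colWeight_pos ha hb ht (k := j / 2 + 1) (by omega)
  have h3 := rowWeight_pos (t := t) (k := j / 2 + 1) (by omega) (by omega)
  unfold cellWeight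
  split_ifs <;> positivity

lemma cellWeight_two_mul (k : ℕ) : cellWeight a b t (2 * k)
    = a * colWeight a b t k * rowWeight t (k + 1) := by
  rw [cellWeight, if_pos (even_two_mul k), Nat.mul_div_cancel_left _ two_pos]

lemma cellWeight_two_mul_add_one (k : ℕ) : cellWeight a b t (2 * k + 1)
    = b * rowWeight t (k + 1) * colWeight a b t (k + 1) := by
  rw [cellWeight, if_neg (Nat.not_even_two_mul_add_one k),
    show (2 * k + 1) / 2 = k by omega]

lemma sum_cellWeight_row {k : ℕ} (hk : k < t) :
    ∑ j ∈ Finset.univ.filter (fun j : Fin (2 * t) => (j : ℕ) / 2 = k),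
        cellWeight a b t j
      = (a ^ 2 + b ^ 2 + 2 * (a * b) * Real.cos (Real.pi / (t + 1))) *
        rowWeight t (k + 1) ^ 2 := by
  have h : (Finset.univ.filter fun j : Fin (2 * t) => (j : ℕ) / 2 = k)
      = {⟨2 * k, by omega⟩, ⟨2 * k + 1, by omega⟩} := by
    ext j
    simp only [Finset.mem_filter, Finset.mem_univ, true_and, Finset.mem_insert,
      Finset.mem_singleton, Fin.ext_iff]
    omega
  rw [h, Finset.sum_pair (by simp), cellWeight_two_mul, cellWeight_two_mul_add_one]
  have := rowWeight_add_rowWeight t k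
  unfold colWeight
  linear_combination a * b * rowWeight t (k + 1) * this

lemma sum_cellWeight_col {k : ℕ} (hk : k ≤ t) :
    ∑ j ∈ Finset.univ.filter (fun j : Fin (2 * t) => ((j : ℕ) + 1) / 2 = k),
        cellWeight a b t j
      = colWeight a b t k ^ 2 := by
  have hlast : cellWeight a b t (2 * t) = 0 := by
    rw [cellWeight_two_mul, rowWeight_succ_self, mul_zero]
  have h : ∑ j ∈ Finset.univ.filter (fun j : Fin (2 * t) => ((j : ℕ) + 1) / 2 = k),
        cellWeight a b t j
      = ∑ j ∈ Finset.range (2 * t + 1) with (j + 1) / 2 = k, cellWeight a b t j := by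
    rw [Finset.sum_filter, Finset.sum_filter, Finset.sum_range_succ, hlast, ite_self, add_zero,
      Finset.sum_range]
  rw [h]
  rcases Nat.eq_zero_or_pos k with rfl | h0
  · have : (Finset.range (2 * t + 1)).filter (fun j => (j + 1) / 2 = 0) = {0} := by
      ext j
      simp only [Finset.mem_filter, Finset.mem_range, Finset.mem_singleton]
      omega
    have h2 := cellWeight_two_mul (a := a) (b := b) (t := t) 0
    rw [mul_zero] at h2
    rw [this, Finset.sum_singleton, h2]
    unfold colWeight
    rw [rowWeight_zero]
    ring
  · obtain ⟨k, rfl⟩ := Nat.exists_eq_succ_of_ne_zero h0.ne'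
    have : (Finset.range (2 * t + 1)).filter (fun j => (j + 1) / 2 = k.succ)
        = {2 * k + 1, 2 * (k + 1)} := by
      ext j
      simp only [Finset.mem_filter, Finset.mem_range, Finset.mem_insert, Finset.mem_singleton]
      omega
    rw [this, Finset.sum_pair (by omega), cellWeight_two_mul, cellWeight_two_mul_add_one,
      Nat.succ_eq_add_one]
    unfold colWeight
    ring

lemma StaircaseData.col_eq_iff (S : StaircaseData) (j j' : ℕ) :
    (S.pos j).1 = (S.pos j').1 ↔ (j + 1) / 2 = (j' + 1) / 2 := by
  refine ⟨S.colOnly j j', fun h => ?_⟩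
  have key : ∀ j, (S.pos j).1 = (S.pos (2 * ((j + 1) / 2))).1 := by
    intro j
    obtain ⟨i, rfl | rfl⟩ := Nat.even_or_odd' j
    · rw [show (2 * i + 1) / 2 = i by omega]
    · rw [show 2 * ((2 * i + 1 + 1) / 2) = 2 * i + 2 by omega, S.colEq]
  rw [key j, key j', h]

lemma StaircaseData.row_eq_iff (S : StaircaseData) (j j' : ℕ) :
    (S.pos j).2 = (S.pos j').2 ↔ j / 2 = j' / 2 := by
  refine ⟨S.rowOnly j j', fun h => ?_⟩
  have key : ∀ j, (S.pos j).2 = (S.pos (2 * (j / 2))).2 := by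
    intro j
    obtain ⟨i, rfl | rfl⟩ := Nat.even_or_odd' j
    · rw [show 2 * i / 2 = i by omega]
    · rw [show 2 * ((2 * i + 1) / 2) = 2 * i by omega, S.rowEq]
  rw [key j, key j', h]

lemma StaircaseData.Mstep_pos (S : StaircaseData) (C D : ∀ m, Set (Perm m)) (j : Fin (2 * t)) :
    S.Mstep C D t (S.pos j).1 (S.pos j).2 = if Even (j : ℕ) then C else D := by
  unfold StaircaseData.Mstep
  have hj := j.2
  obtain ⟨i, hi | hi⟩ := Nat.even_or_odd' (j : ℕ)
  · rw [if_pos ⟨i, by omega, by rw [hi]⟩, if_pos (by rw [hi]; exact even_two_mul i)]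
  · rw [if_neg, if_pos ⟨i, by omega, by rw [hi]⟩,
      if_neg (by rw [hi]; exact Nat.not_even_two_mul_add_one i)]
    rintro ⟨i', -, h⟩
    have := S.inj h
    omega

lemma StaircaseData.Mstep_of_ne (S : StaircaseData) (C D : ∀ m, Set (Perm m)) (k l : ℕ)
    (h : ∀ j : Fin (2 * t), S.pos j ≠ (k, l)) : S.Mstep C D t k l = emptyCell := by
  unfold StaircaseData.Mstep
  rw [if_neg, if_neg]
  · rintro ⟨i, hi, he⟩
    exact h ⟨2 * i + 1, by omega⟩ he
  · rintro ⟨i, hi, he⟩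
    exact h ⟨2 * i, by omega⟩ he

lemma StaircaseData.cellWeight_balance (S : StaircaseData) {x y : ℝ} (hx : 0 ≤ x) (hy : 0 ≤ y)
    (j : Fin (2 * t)) :
    (if Even (j : ℕ) then x else y) *
      ((∑ j' ∈ Finset.univ.filter (fun j' : Fin (2 * t) => (S.pos j').1 = (S.pos j).1),
        cellWeight √x √y t j') *
        ∑ j' ∈ Finset.univ.filter (fun j' : Fin (2 * t) => (S.pos j').2 = (S.pos j).2),
        cellWeight √x √y t j')
      = (x + y + 2 * √(x * y) * Real.cos (Real.pi / (t + 1))) * cellWeight √x √y t j ^ 2 := by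
  have hj := j.2
  simp only [S.col_eq_iff, S.row_eq_iff]
  rw [sum_cellWeight_row (by omega), sum_cellWeight_col (by omega), Real.sqrt_mul hx]
  obtain ⟨i, hi | hi⟩ := Nat.even_or_odd' (j : ℕ)
  · rw [hi, if_pos (even_two_mul i), cellWeight_two_mul, show (2 * i + 1) / 2 = i by omega,
      show 2 * i / 2 = i by omega, mul_pow, mul_pow, Real.sq_sqrt hx, Real.sq_sqrt hy]
    ring
  · rw [hi, if_neg (Nat.not_even_two_mul_add_one i), cellWeight_two_mul_add_one,
      show (2 * i + 1 + 1) / 2 = i + 1 by omega,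
      show (2 * i + 1) / 2 = i by omega, mul_pow, mul_pow, Real.sq_sqrt hx, Real.sq_sqrt hy]
    ring

end Staircase

/-- If `C` and `D` have finite proper growth rates `gC` and `gD`, then for
every `t ≥ 1` the `t`-step restriction of any infinite `(C, D)` staircase has proper growth
rate `gC + gD + 2·√(gC·gD)·cos (π/(t+1))`. -/
theorem tstep_staircase_growth (C D : PermClass) (gC gD : ℝ)
    (hC : HasGrowth C.mem gC) (hD : HasGrowth D.mem gD) (S : StaircaseData)
    (t : ℕ) (ht : 1 ≤ t) :
    HasGrowth (gridSet (S.Mstep C.mem D.mem t))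
      (gC + gD + 2 * Real.sqrt (gC * gD) * Real.cos (Real.pi / (t + 1))) := by
  have : Nonempty (Fin (2 * t)) := ⟨⟨0, by omega⟩⟩
  let pos : Fin (2 * t) → ℕ × ℕ := fun j => S.pos j
  let F : Fin (2 * t) → ∀ m, Set (Perm m) := fun j => if Even (j : ℕ) then C.mem else D.mem
  have hpos : Function.Injective pos := fun j j' h => Fin.ext (S.inj h)
  have hM : ∀ j, S.Mstep C.mem D.mem t (pos j).1 (pos j).2 = F j := S.Mstep_pos _ _
  have hM' : ∀ k l, (∀ j, pos j ≠ (k, l)) → S.Mstep C.mem D.mem t k l = emptyCell :=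
    S.Mstep_of_ne _ _
  have hF : ∀ j, HasGrowth (F j) (if Even (j : ℕ) then gC else gD) := by
    intro j
    simp only [F]
    split_ifs
    · exact hC
    · exact hD
  have hcos : 0 ≤ Real.cos (Real.pi / (t + 1)) := by
    have ht' : (1 : ℝ) ≤ t := Nat.one_le_cast.2 ht
    refine Real.cos_nonneg_of_neg_pi_div_two_le_of_le ?_ ?_
    · have : 0 ≤ Real.pi / (t + 1) := by positivity
      linarith [Real.pi_pos]
    · exact div_le_div_of_nonneg_left Real.pi_pos.le two_pos (by linarith)
  have hweight : ∀ x y : ℝ, 0 < x → 0 < y → ∀ j : Fin (2 * t), 0 < cellWeight √x √y t j :=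
    fun x y hx hy j => cellWeight_pos (Real.sqrt_pos.2 hx) (Real.sqrt_pos.2 hy) ht j.2
  refine tendsto_order.2 ⟨fun μ hμ => ?_, fun μ hμ => ?_⟩
  · rcases hC.nonneg.eq_or_lt with h0 | hCpos
    · have hlim : Tendsto (growthSeq (withEmpty (F ⟨1, by omega⟩))) atTop (𝓝 gD) :=
        (hF ⟨1, by omega⟩).withEmpty
      rw [← h0, zero_mul, Real.sqrt_zero, mul_zero, zero_mul, add_zero, zero_add] at hμ
      filter_upwards [hlim.eventually_const_lt hμ] with n hn
      exact hn.trans_le (growthSeq_withEmpty_le hpos hM _ n)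
    rcases hD.nonneg.eq_or_lt with h0 | hDpos
    · have hlim : Tendsto (growthSeq (withEmpty (F ⟨0, by omega⟩))) atTop (𝓝 gC) :=
        (hF ⟨0, by omega⟩).withEmpty
      rw [← h0, mul_zero, Real.sqrt_zero, mul_zero, zero_mul, add_zero, add_zero] at hμ
      filter_upwards [hlim.eventually_const_lt hμ] with n hn
      exact hn.trans_le (growthSeq_withEmpty_le hpos hM _ n)
    refine eventually_lt_growthSeq_gridSet hpos hM (fun j => Even (j : ℕ)) (fun j => Even (j : ℕ))
      ?_ ?_ (hweight gC gD hCpos hDpos) (S.cellWeight_balance hCpos.le hDpos.le) ?_ hF hμ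
    · intro j j' h h'
      have h1 := S.colOnly _ _ h
      rw [Nat.even_iff, Nat.even_iff] at h'
      refine Fin.ext ?_
      omega
    · intro j j' h h'
      have h1 := S.rowOnly _ _ h
      rw [Nat.even_iff, Nat.even_iff] at h'
      refine Fin.ext ?_
      omega
    · intro j
      split_ifs
      · exact hCpos
      · exact hDpos
  · have hcont : Continuous fun ε : ℝ => (gC + ε) + (gD + ε) +
        2 * √((gC + ε) * (gD + ε)) * Real.cos (Real.pi / (t + 1)) := by fun_prop
    have hε : ∀ᶠ ε in 𝓝[>] (0 : ℝ), (gC + ε) + (gD + ε) +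
        2 * √((gC + ε) * (gD + ε)) * Real.cos (Real.pi / (t + 1)) < μ := by
      refine (tendsto_nhdsWithin_of_tendsto_nhds (hcont.tendsto 0)).eventually_lt_const ?_
      simpa using hμ
    obtain ⟨ε, hεμ, hε0⟩ := (hε.and self_mem_nhdsWithin).exists
    have hε0' : 0 < ε := hε0
    have hx : 0 < gC + ε := by linarith [hC.nonneg]
    have hy : 0 < gD + ε := by linarith [hD.nonneg]
    refine eventually_growthSeq_gridSet_lt hpos hM hM' (hweight _ _ hx hy)
      (S.cellWeight_balance hx.le hy.le) hF (fun j => ?_) (by positivity) hεμ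
    split_ifs <;> linarith
end

section
/- For all nonempty permutations α, β, and γ, Av(α⊖β⊖γ) ⊆ Av(α⊖β) ⊙ Av(β⊖γ); that is, every permutation avoiding α⊖β⊖γ can have its entries partitioned into a subsequence order isomorphic to an (α⊖β)-avoiding permutation and a subsequence order isomorphic to a (β⊖γ)-avoiding permutation. -/
open Filter Topology ENNReal

/-- `f` lists, from left to right, the positions of an occurrence of `σ` in `π`. -/
structure IsOccurrence {k n : ℕ} (σ : Perm k) (π : Perm n) (f : Fin k → Fin n) : Prop where
  strictMono : StrictMono f
  lt_iff : ∀ i j, σ i < σ j ↔ π (f i) < π (f j)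

lemma IsOccurrence.pattern {k n : ℕ} {σ : Perm k} {π : Perm n} {f : Fin k → Fin n}
    (h : IsOccurrence σ π f) : Pattern σ π :=
  ⟨OrderEmbedding.ofStrictMono f h.strictMono, h.lt_iff⟩

lemma skewSum_castAdd {a b : ℕ} (α : Perm a) (β : Perm b) (i : Fin a) :
    (skewSum α β (Fin.castAdd b i) : ℕ) = b + α i := by
  simp [skewSum, Nat.add_comm]

lemma skewSum_natAdd {a b : ℕ} (α : Perm a) (β : Perm b) (j : Fin b) :
    (skewSum α β (Fin.natAdd a j) : ℕ) = β j := by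
  simp [skewSum]

/-- An occurrence of `α` lying above and to the left of an occurrence of `β` gives an
occurrence of `α ⊖ β`. -/
lemma IsOccurrence.skewSum {a b n : ℕ} {α : Perm a} {β : Perm b} {π : Perm n}
    {f : Fin a → Fin n} {g : Fin b → Fin n} (hf : IsOccurrence α π f) (hg : IsOccurrence β π g)
    (hpos : ∀ i j, f i < g j) (hval : ∀ i j, π (g j) < π (f i)) :
    IsOccurrence (skewSum α β) π (Fin.addCases f g) := by
  constructor
  · intro x y hxy
    induction x using Fin.addCases <;> induction y using Fin.addCases <;>
      simp only [Fin.addCases_left, Fin.addCases_right]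
    · exact hf.strictMono hxy
    · exact hpos _ _
    · simp only [Fin.lt_def, Fin.val_castAdd, Fin.val_natAdd] at hxy
      omega
    · exact hg.strictMono (by simpa using hxy)
  · intro x y
    induction x using Fin.addCases with
    | left i =>
      induction y using Fin.addCases with
      | left j =>
        rw [Fin.lt_def, skewSum_castAdd, skewSum_castAdd, Fin.addCases_left, Fin.addCases_left,
          ← hf.lt_iff, Fin.lt_def]
        omega
      | right j =>
        rw [Fin.lt_def, skewSum_castAdd, skewSum_natAdd, Fin.addCases_left, Fin.addCases_right]
        have hlt := (β j).isLt
        exact iff_of_false (by omega) (hval i j).not_gt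
    | right i =>
      induction y using Fin.addCases with
      | left j =>
        rw [Fin.lt_def, skewSum_castAdd, skewSum_natAdd, Fin.addCases_left, Fin.addCases_right]
        have hlt := (β i).isLt
        exact iff_of_true (by omega) (hval j i)
      | right j =>
        rw [Fin.lt_def, skewSum_natAdd, skewSum_natAdd, Fin.addCases_right, Fin.addCases_right,
          ← hg.lt_iff, Fin.lt_def]

lemma IsOccurrence.left_of_skewSum {a b n : ℕ} {α : Perm a} {β : Perm b} {π : Perm n}
    {h : Fin (a + b) → Fin n} (hh : IsOccurrence (_root_.skewSum α β) π h) :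
    IsOccurrence α π fun i => h (Fin.castAdd b i) := by
  refine ⟨fun i j hij => hh.strictMono (Fin.strictMono_castAdd b hij), fun i j => ?_⟩
  rw [← hh.lt_iff, Fin.lt_def, Fin.lt_def, skewSum_castAdd, skewSum_castAdd]
  omega

lemma IsOccurrence.right_of_skewSum {a b n : ℕ} {α : Perm a} {β : Perm b} {π : Perm n}
    {h : Fin (a + b) → Fin n} (hh : IsOccurrence (_root_.skewSum α β) π h) :
    IsOccurrence β π fun j => h (Fin.natAdd a j) := by
  refine ⟨fun i j hij => hh.strictMono (by simpa using hij), fun i j => ?_⟩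
  rw [← hh.lt_iff, Fin.lt_def, Fin.lt_def, skewSum_natAdd, skewSum_natAdd]

lemma IsOccurrence.left_lt_right {a b n : ℕ} {α : Perm a} {β : Perm b} {π : Perm n}
    {h : Fin (a + b) → Fin n} (hh : IsOccurrence (_root_.skewSum α β) π h)
    (i : Fin a) (j : Fin b) : h (Fin.castAdd b i) < h (Fin.natAdd a j) :=
  hh.strictMono (by simp only [Fin.lt_def, Fin.val_castAdd, Fin.val_natAdd]; omega)

lemma IsOccurrence.right_val_lt_left_val {a b n : ℕ} {α : Perm a} {β : Perm b} {π : Perm n}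
    {h : Fin (a + b) → Fin n} (hh : IsOccurrence (_root_.skewSum α β) π h)
    (i : Fin a) (j : Fin b) : π (h (Fin.natAdd a j)) < π (h (Fin.castAdd b i)) := by
  rw [← hh.lt_iff, Fin.lt_def, skewSum_natAdd, skewSum_castAdd]
  omega

/-- If no occurrence of `τ` in `π` is contained in `A`, then the entries of `π` at the positions
in `A` form a sequence order isomorphic to a permutation avoiding `τ`. -/
lemma subpermIn_avSet {k n : ℕ} {τ : Perm k} {π : Perm n} {A : Set (Fin n)}
    (hA : ∀ f, IsOccurrence τ π f → ¬ ∀ i, f i ∈ A) : SubpermIn π A (avSet τ) := by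
  classical
  let s := A.toFinset
  let f := s.orderEmbOfFin rfl
  let e := (s.map π.toEmbedding).orderIsoOfFin (Finset.card_map _)
  have hf : ∀ i, π (f i) ∈ s.map π.toEmbedding := fun i =>
    Finset.mem_map_of_mem π.toEmbedding (s.orderEmbOfFin_mem rfl i)
  let σ : Fin s.card → Fin s.card := fun i => e.symm ⟨π (f i), hf i⟩
  have hσ : ∀ i j, σ i < σ j ↔ π (f i) < π (f j) := fun i j => by
    simp only [σ, OrderIso.lt_iff_lt, Subtype.mk_lt_mk]
  have hinj : Function.Injective σ := fun i j hij => by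
    simpa [σ] using hij
  refine ⟨s.card, Equiv.ofBijective σ (Finite.injective_iff_bijective.1 hinj), f, ?_, hσ, ?_⟩
  · simp [f, s]
  · rintro ⟨g, hg⟩
    refine hA (fun i => f (g i)) ⟨f.strictMono.comp g.strictMono, fun i j => ?_⟩ fun i => ?_
    · rw [hg, ← hσ]
      rfl
    · exact Set.mem_toFinset.1 (s.orderEmbOfFin_mem rfl (g i))

/-- A subset of a well-founded order may be specified by deciding the membership of each element
from the membership of the smaller ones. -/
lemma exists_set_mem_iff_of_wellFoundedLT {ι : Type*} [Preorder ι] [WellFoundedLT ι]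
    (P : ι → Set ι → Prop) : ∃ S : Set ι, ∀ i, i ∈ S ↔ P i {j | j < i ∧ j ∈ S} := by
  let F : (i : ι) → ((j : ι) → j < i → Prop) → Prop := fun i ih => P i {j | ∃ h : j < i, ih j h}
  refine ⟨{i | (wellFounded_lt (α := ι)).fix F i}, fun i => ?_⟩
  rw [Set.mem_ofPred_eq, WellFounded.fix_eq]
  simp only [F, exists_prop, Set.mem_ofPred_eq]

/-- The left-to-right greedy selection: an entry is selected unless it lies below and to the right
of an unselected entry, or completes an occurrence of `τ` among the selected entries. -/
lemma exists_greedy_avoiding {k n : ℕ} (τ : Perm k) (π : Perm n) :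
    ∃ R : Set (Fin n), ∀ i, i ∈ R ↔ (∀ j < i, π i < π j → j ∈ R) ∧
      ∀ h, IsOccurrence τ π h → ¬ ∀ x, h x < i ∧ h x ∈ R ∨ h x = i := by
  obtain ⟨R, hR⟩ := exists_set_mem_iff_of_wellFoundedLT fun (i : Fin n) S =>
    (∀ j < i, π i < π j → j ∈ S) ∧ ∀ h, IsOccurrence τ π h → ¬ ∀ x, h x ∈ S ∨ h x = i
  refine ⟨R, fun i => (hR i).trans (and_congr_left fun _ => ?_)⟩
  exact forall₃_congr fun j hj _ => and_iff_right hj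

/-- For all nonempty permutations `α`, `β`, `γ`,
`Av(α ⊖ β ⊖ γ) ⊆ Av(α ⊖ β) ⊙ Av(β ⊖ γ)`. -/
theorem av_skew_triple_subset_merge {a b c : ℕ} (ha : 0 < a) (hb : 0 < b) (hc : 0 < c)
    (α : Perm a) (β : Perm b) (γ : Perm c) (n : ℕ) :
    avSet (skewSum α (skewSum β γ)) n ⊆
      mergeSet (avSet (skewSum α β)) (avSet (skewSum β γ)) n := by
  intro π hπ
  obtain ⟨R, hR⟩ := exists_greedy_avoiding (skewSum α β) π
  have hred : ∀ h, IsOccurrence (skewSum α β) π h → ¬ ∀ x, h x ∈ R := by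
    intro h hh hmem
    have hlast : a + b - 1 < a + b := by omega
    refine ((hR (h ⟨a + b - 1, hlast⟩)).1 (hmem _)).2 h hh fun x => ?_
    have hle : x ≤ ⟨a + b - 1, hlast⟩ := Fin.le_def.2 (by have := x.isLt; simp only; omega)
    rcases (hh.strictMono.monotone hle).lt_or_eq with hlt | heq
    · exact Or.inl ⟨hlt, hmem x⟩
    · exact Or.inr heq
  have hblue : ∀ x, x ∉ R → ∃ p ≤ x, π x ≤ π p ∧ ∃ h, IsOccurrence (skewSum α β) π h ∧
      ∀ k, h k < p ∧ h k ∈ R ∨ h k = p := by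
    intro x
    induction x using WellFoundedLT.induction with
    | ind x ih =>
      intro hx
      by_cases hdom : ∀ j < x, π x < π j → j ∈ R
      · by_contra hno
        exact hx ((hR x).2 ⟨hdom, fun h hh hk => hno ⟨x, le_rfl, le_rfl, h, hh, hk⟩⟩)
      · push Not at hdom
        obtain ⟨j, hj, hxj, hjR⟩ := hdom
        obtain ⟨p, hp, hpj, hrest⟩ := ih j hj hjR
        exact ⟨p, hp.trans hj.le, hxj.le.trans hpj, hrest⟩
  refine ⟨R, subpermIn_avSet hred, subpermIn_avSet fun h hh hmem => ?_⟩
  let f : Fin b → Fin n := fun j => h (Fin.castAdd c j)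
  let g : Fin c → Fin n := fun k => h (Fin.natAdd b k)
  have hf : IsOccurrence β π f := hh.left_of_skewSum
  have hg : IsOccurrence γ π g := hh.right_of_skewSum
  have hfg : ∀ j k, f j < g k := hh.left_lt_right
  have hgf : ∀ j k, π (g k) < π (f j) := hh.right_val_lt_left_val
  let first : Fin b := ⟨0, hb⟩
  let top : Fin b := β.symm ⟨b - 1, by omega⟩
  have hfirst : ∀ j, f first ≤ f j := fun j =>
    hf.strictMono.monotone (Fin.le_def.2 (Nat.zero_le _))
  have htop : ∀ j, π (f j) ≤ π (f top) := fun j => by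
    rw [← not_lt, ← hf.lt_iff, Fin.lt_def, Equiv.apply_symm_apply]
    have := (β j).isLt
    simp only
    omega
  obtain ⟨p, hptop, hpval, q, hq, hqp⟩ := hblue (f top) (hmem _)
  let u : Fin a → Fin n := fun i => q (Fin.castAdd b i)
  let v : Fin b → Fin n := fun j => q (Fin.natAdd a j)
  have hu : IsOccurrence α π u := hq.left_of_skewSum
  have hv : IsOccurrence β π v := hq.right_of_skewSum
  have huv : ∀ i j, u i < v j := hq.left_lt_right
  have hvu : ∀ i j, π (v j) < π (u i) := hq.right_val_lt_left_val
  have hqle : ∀ k, q k ≤ p := fun k => (hqp k).elim (fun hk => hk.1.le) le_of_eq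
  have hup : ∀ i, π p < π (u i) := by
    intro i
    obtain ⟨k, hk⟩ : ∃ k, q k = p := by
      by_contra! hne
      exact hred q hq fun k => ((hqp k).resolve_right (hne k)).2
    induction k using Fin.addCases with
    | left k => exact absurd (huv k first) (by rw [not_lt, show u k = p from hk]; exact hqle _)
    | right k => exact hk ▸ hvu i k
  have huf : ∀ i j, π (f j) < π (u i) := fun i j => ((htop j).trans hpval).trans_lt (hup i)
  have triple : ∀ w : Fin b → Fin n, IsOccurrence β π w → (∀ i j, u i < w j) →
      (∀ i j, π (w j) < π (u i)) → (∀ j k, w j < g k) → (∀ j k, π (g k) < π (w j)) → False := by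
    intro w hw huw hwu hwg hgw
    refine hπ (hu.skewSum (hw.skewSum hg hwg hgw) (fun i x => ?_) fun i x => ?_).pattern
    · induction x using Fin.addCases with
      | left j => simpa using huw i j
      | right k => simpa using (huw i first).trans (hwg first k)
    · induction x using Fin.addCases with
      | left j => simpa using hwu i j
      | right k => simpa using (hgw first k).trans (hwu i first)
  by_cases hleft : ∀ i, u i < f first
  · exact triple f hf (fun i j => (hleft i).trans_le (hfirst j)) huf hfg hgf
  push Not at hleft
  obtain ⟨i, hi⟩ := hleft
  refine triple v hv huv hvu (fun j k => ((hqle _).trans hptop).trans_lt (hfg top k)) fun j k => ?_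
  by_contra! hjk
  rcases hqp (Fin.natAdd a j) with ⟨-, hjR⟩ | hjp
  · exact hmem (Fin.castAdd c first)
      (((hR _).1 hjR).1 _ (hi.trans_lt (huv i j)) (hjk.trans_lt (hgf first k)))
  · exact absurd ((hgf top k).trans_le hpval) (not_lt.2 (hjp ▸ hjk))
end
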